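/- Konvalinka–Lauve's Corollary 6: for all partitions λ, μ, Σ_ν t^{n(ν)} f_{μν}^λ(t) = sk_{λ/μ}(t), where the sum is over all partitions ν and n(ν) = Σ_{i≥1}(i−1)ν_i. -/

import Mathlib

/-!
Common framework: integer partitions, Gaussian binomials, Hall--Littlewood
Pieri coefficients, the ring of symmetric functions realized as polynomials
in the power sums, the Macdonald `(q,t)`-inner product, a characterisation
of the Macdonald polynomials `P_λ(X;q,t)`, skew Macdonald polynomials,
plethystic evaluations and the various Pieri coefficients of
Konvalinka--Lauve and Warnaar.
-/

open scoped BigOperators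

noncomputable section

namespace SkewPieriFormalization

/-- An integer partition, encoded as a finitely supported weakly decreasing
sequence of natural numbers; `part j` is the part `λ_{j+1}` (0-indexed). -/
structure Partition where
  part : ℕ →₀ ℕ
  antitone' : ∀ ⦃i j : ℕ⦄, i ≤ j → part j ≤ part i

namespace Partition

/-- Containment of Young diagrams: `μ ≤ λ` iff `μ_i ≤ λ_i` for all `i`. -/
instance : LE Partition := ⟨fun mu lam => ∀ j : ℕ, mu.part j ≤ lam.part j⟩

/-- `|λ|`, the size (sum of the parts). -/
def size (lam : Partition) : ℕ := lam.part.sum fun _ k => k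

/-- `l(λ)`, the number of (nonzero) parts. -/
def length (lam : Partition) : ℕ := lam.part.support.card

/-- `n(λ) = ∑_{i ≥ 1} (i-1) λ_i`. -/
def nstat (lam : Partition) : ℕ := lam.part.sum fun j k => j * k

/-- the `i`-th part `λ_i` (1-indexed). -/
def row (lam : Partition) (i : ℕ) : ℕ := lam.part (i - 1)

/-- the part `λ'_i = #{j : λ_j ≥ i}` of the conjugate partition (for `i ≥ 1`). -/
def conj (lam : Partition) (i : ℕ) : ℕ :=
  (lam.part.support.filter fun j => i ≤ lam.part j).card

/-- the multiplicity `m_r(λ)` of `r` as a part of `λ`. -/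
def mult (lam : Partition) (r : ℕ) : ℕ :=
  (lam.part.support.filter fun j => lam.part j = r).card

/-- `z_λ = ∏_{r ≥ 1} r^{m_r} m_r!`. -/
def zee (lam : Partition) : ℕ :=
  ∏ r ∈ Finset.Icc 1 (lam.part 0), r ^ lam.mult r * Nat.factorial (lam.mult r)

/-- the partial sum `λ_1 + ⋯ + λ_k`. -/
def psum (lam : Partition) (k : ℕ) : ℕ := ∑ j ∈ Finset.range k, lam.part j

/-- dominance order: `λ ⊵ μ` (for `|λ| = |μ|`). -/
def Dominates (lam mu : Partition) : Prop :=
  mu.size = lam.size ∧ ∀ k : ℕ, mu.psum k ≤ lam.psum k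

/-- the one-row partition `(r)`. -/
def single (r : ℕ) : Partition where
  part := Finsupp.single 0 r
  antitone' := by
    intro i j hij
    by_cases hj : j = 0
    · have : i = 0 := by omega
      simp [hj, this]
    · simp only [Finsupp.single_apply]
      split <;> split <;> omega

/-- the one-column partition `(1^m)`. -/
def column (m : ℕ) : Partition where
  part := Finsupp.onFinset (Finset.range m) (fun j => if j < m then 1 else 0)
    (fun j h => by
      simp only [Finset.mem_range]
      by_contra hc
      simp [hc] at h)
  antitone' := by
    intro i j hij
    simp only [Finsupp.onFinset_apply]
    split <;> split <;> omega

end Partition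

variable {F : Type*} [Field F]

/-- the `t`-integer `[n]_t = 1 + t + ⋯ + t^{n-1}`. -/
def qint (t : F) (n : ℕ) : F := ∑ j ∈ Finset.range n, t ^ j

/-- the `t`-factorial. -/
def qfac (t : F) (n : ℕ) : F := ∏ j ∈ Finset.range n, qint t (j + 1)

/-- the Gaussian binomial coefficient `[n choose k]_t`; it vanishes
unless `0 ≤ k ≤ n`. -/
def qbinom (t : F) (n k : ℤ) : F :=
  if 0 ≤ k ∧ k ≤ n then qfac t n.toNat / (qfac t k.toNat * qfac t (n - k).toNat) else 0

/-- the Hall--Littlewood Pieri coefficient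
`ψ'_{λ/μ}(t) = ∏_{i ≥ 1} [λ'_i - λ'_{i+1} choose λ'_i - μ'_i]_t`;
it vanishes unless `μ ⊆ λ` with `λ - μ` a vertical strip. -/
def vsHL (t : F) (lam mu : Partition) : F :=
  ∏ i ∈ Finset.Icc 1 (lam.part 0 + mu.part 0),
    qbinom t ((lam.conj i : ℤ) - lam.conj (i + 1)) ((lam.conj i : ℤ) - mu.conj i)

open Classical in
/-- the Hall--Littlewood Pieri coefficient `φ_{λ/μ}(t)`, equal to
`∏ (1 - t^{λ'_i - λ'_{i+1}})` over those `i ≥ 1` with `λ'_i = μ'_i + 1` and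
`λ'_{i+1} = μ'_{i+1}`, when `μ ⊆ λ` with `λ - μ` a horizontal strip, and
vanishing otherwise. -/
def hsHL (t : F) (lam mu : Partition) : F :=
  if ∀ i : ℕ, mu.conj i ≤ lam.conj i ∧ lam.conj i ≤ mu.conj i + 1 then
    ∏ i ∈ Finset.Icc 1 (lam.part 0 + mu.part 0),
      if lam.conj i = mu.conj i + 1 ∧ lam.conj (i + 1) = mu.conj (i + 1) then
        1 - t ^ (lam.conj i - lam.conj (i + 1))
      else 1
  else 0

/-- `n(λ/μ) = ∑_{i ≥ 1} C(λ'_i - μ'_i, 2)`. -/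
def nskew (lam mu : Partition) : ℕ :=
  ∑ i ∈ Finset.Icc 1 (lam.part 0 + mu.part 0), Nat.choose (lam.conj i - mu.conj i) 2

/-- the Konvalinka--Lauve coefficient
`sk_{λ/μ}(t) = t^{n(λ/μ)} ∏_{i ≥ 1} [λ'_i - μ'_{i+1} choose λ'_i - μ'_i]_t`;
it vanishes unless `μ ⊆ λ`. -/
def skHL (t : F) (lam mu : Partition) : F :=
  t ^ nskew lam mu *
    ∏ i ∈ Finset.Icc 1 (lam.part 0 + mu.part 0),
      qbinom t ((lam.conj i : ℤ) - mu.conj (i + 1)) ((lam.conj i : ℤ) - mu.conj i)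

/-- The ring of symmetric functions over `F`, realized as the polynomial ring
in the power sums: the variable `n` is the power sum `p_{n+1}`. -/
abbrev Sym (F : Type*) [Field F] := MvPolynomial ℕ F

/-- the power sum product `p_λ = p_{λ_1} p_{λ_2} ⋯`. -/
def pprod (lam : Partition) : Sym F :=
  ∏ j ∈ lam.part.support, MvPolynomial.X (lam.part j - 1)

/-- Macdonald's `(q,t)`-deformation of the Hall inner product, for which the
power sums are orthogonal with `⟨p_λ, p_λ⟩ = z_λ ∏_i (1-q^{λ_i})/(1-t^{λ_i})`. -/
def innerQT (q t : F) (f g : Sym F) : F :=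
  ∑ d ∈ f.support,
    f.coeff d * g.coeff d *
      d.prod fun n m =>
        (((n : F) + 1) ^ m * (Nat.factorial m : F)) *
          ((1 - q ^ (n + 1)) / (1 - t ^ (n + 1))) ^ m

/-- the complete homogeneous symmetric function `h_r = ∑_{|κ| = r} z_κ⁻¹ p_κ`. -/
def hsym (F : Type*) [Field F] (r : ℕ) : Sym F :=
  ∑ᶠ (k : Partition) (_ : k.size = r), ((k.zee : F))⁻¹ • (pprod k : Sym F)

/-- the elementary symmetric function `e_r = ∑_{|κ| = r} (-1)^{r - l(κ)} z_κ⁻¹ p_κ`. -/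
def esym (F : Type*) [Field F] (r : ℕ) : Sym F :=
  ∑ᶠ (k : Partition) (_ : k.size = r),
    ((-1 : F) ^ (r - k.length) * (k.zee : F)⁻¹) • (pprod k : Sym F)

/-- `h_μ = h_{μ_1} h_{μ_2} ⋯`. -/
def hprod (F : Type*) [Field F] (mu : Partition) : Sym F :=
  ∏ j ∈ mu.part.support, hsym F (mu.part j)

/-- Characterisation of the (monic) Macdonald polynomial family
`λ ↦ P_λ(X;q,t)`: the `P_λ` are pairwise orthogonal for the `(q,t)`-inner
product, and `P_λ = m_λ + ∑_{μ ⊲ λ} u_{λμ} m_μ` is unitriangular with respect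
to dominance order in the monomial basis.  Since `{h_μ}` is the dual basis of
`{m_μ}` for the classical Hall pairing (the case `q = t`), unitriangularity is
expressed by the last two conditions.  For `q = 0` this characterises the
Hall--Littlewood polynomials `P_λ(X;t)`. -/
def IsMacdonald (q t : F) (P : Partition → Sym F) : Prop :=
  (∀ lam mu, lam ≠ mu → innerQT q t (P lam) (P mu) = 0) ∧
  (∀ lam, innerQT t t (P lam) (hprod F lam) = 1) ∧
  (∀ lam mu, ¬ Partition.Dominates lam mu → innerQT t t (P lam) (hprod F mu) = 0)

/-- `b_λ = ⟨P_λ, P_λ⟩⁻¹`. -/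
def bnorm (q t : F) (P : Partition → Sym F) (lam : Partition) : F :=
  (innerQT q t (P lam) (P lam))⁻¹

/-- `Q_λ = b_λ P_λ`. -/
def macQ (q t : F) (P : Partition → Sym F) (lam : Partition) : Sym F :=
  bnorm q t P lam • P lam

/-- the skew Macdonald polynomial `Q_{λ/μ}`, defined by
`⟨Q_{λ/μ}, P_ν⟩ = ⟨Q_λ, P_μ P_ν⟩`. -/
def skewQ (q t : F) (P : Partition → Sym F) (lam mu : Partition) : Sym F :=
  ∑ᶠ nu : Partition, innerQT q t (macQ q t P lam) (P mu * P nu) • macQ q t P nu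

/-- the skew Macdonald polynomial `P_{λ/μ}`, defined by
`⟨P_{λ/μ}, Q_ν⟩ = ⟨P_λ, Q_μ Q_ν⟩`. -/
def skewP (q t : F) (P : Partition → Sym F) (lam mu : Partition) : Sym F :=
  ∑ᶠ nu : Partition, innerQT q t (P lam) (macQ q t P mu * macQ q t P nu) • P nu

/-- the Littlewood--Richardson coefficient `f_{μν}^λ(q,t) = ⟨Q_λ, P_μ P_ν⟩`,
so that `P_μ P_ν = ∑_λ f_{μν}^λ P_λ`. -/
def lr (q t : F) (P : Partition → Sym F) (mu nu lam : Partition) : F :=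
  innerQT q t (macQ q t P lam) (P mu * P nu)

/-- the plethystic evaluation `f ↦ f((a-b)/(1-t))`, determined on power sums
by `p_r ↦ (a^r - b^r)/(1 - t^r)`. -/
def plethAB (t a b : F) (f : Sym F) : F :=
  MvPolynomial.eval (fun n => (a ^ (n + 1) - b ^ (n + 1)) / (1 - t ^ (n + 1))) f

/-- `vs_{λ/μ}(q,t) = ψ'_{λ/μ}(q,t) = (-1)^{|λ|-|μ|} Q_{λ/μ}((q-1)/(1-t))`. -/
def vsM (q t : F) (P : Partition → Sym F) (lam mu : Partition) : F :=
  (-1 : F) ^ ((lam.size : ℤ) - (mu.size : ℤ)) * plethAB t q 1 (skewQ q t P lam mu)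

/-- `sk_{λ/μ}(q,t) = Q_{λ/μ}((1-q)/(1-t))`. -/
def skM (q t : F) (P : Partition → Sym F) (lam mu : Partition) : F :=
  plethAB t 1 q (skewQ q t P lam mu)

/-- `ŝk_{λ/μ}(q,t) = Q_{λ/μ}((1-q/t)/(1-t))`. -/
def skHatM (q t : F) (P : Partition → Sym F) (lam mu : Partition) : F :=
  plethAB t 1 (q / t) (skewQ q t P lam mu)

/-- `hs_{λ/μ}(q,t) = φ_{λ/μ}(q,t) = Q_{λ/μ}(1)`, the plethystic evaluation
`p_r ↦ 1`. -/
def hsM (q t : F) (P : Partition → Sym F) (lam mu : Partition) : F :=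
  MvPolynomial.eval (fun _ => (1 : F)) (skewQ q t P lam mu)

/-- `ks_{λ/μ}(q,t) = Q_{λ/μ}(-1)`, the plethystic evaluation `p_r ↦ -1`. -/
def ksM (q t : F) (P : Partition → Sym F) (lam mu : Partition) : F :=
  MvPolynomial.eval (fun _ => (-1 : F)) (skewQ q t P lam mu)

/-- the finite `q`-Pochhammer symbol `(a;q)_k = ∏_{j=0}^{k-1}(1 - a q^j)`. -/
def qPochN (qq a : F) (k : ℕ) : F := ∏ j ∈ Finset.range k, (1 - a * qq ^ j)

/-- the `q`-Pochhammer symbol `(a;q)_k = (a;q)_∞/(a q^k;q)_∞` for `k ∈ ℤ`;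
for `k = -m < 0` it equals `1/∏_{i=1}^m (1 - a q^{-i})`. -/
def qPochZ (qq a : F) (k : ℤ) : F :=
  if 0 ≤ k then qPochN qq a k.toNat
  else (∏ j ∈ Finset.range (-k).toNat, (1 - a * (qq⁻¹) ^ (j + 1)))⁻¹

/-- `(a)_λ = (a;q,t)_λ = ∏_{i ≥ 1} (a t^{1-i}; q)_{λ_i}`. -/
def qtPoch (qq tt a : F) (lam : Partition) : F :=
  ∏ j ∈ lam.part.support, qPochN qq (a * tt ^ (-(j : ℤ))) (lam.part j)

/-- the degree (as a symmetric function) of a power-sum exponent vector. -/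
def wt (d : ℕ →₀ ℕ) : ℕ := d.sum fun n m => (n + 1) * m

/-- the degree-`r` homogeneous component of `∏_x (bx;q)_∞/(ax;q)_∞`, namely
`∑_{|κ| = r} z_κ⁻¹ ∏_i (a^{κ_i} - b^{κ_i})/(1 - q^{κ_i}) · p_κ`. -/
def prodComp (a b qq : F) (r : ℕ) : Sym F :=
  ∑ᶠ (k : Partition) (_ : k.size = r),
    ((k.zee : F)⁻¹ *
        ∏ j ∈ k.part.support,
          (a ^ k.part j - b ^ k.part j) / (1 - qq ^ k.part j)) • (pprod k : Sym F)

/-- `∏_x (bx;q)_∞/(ax;q)_∞`, where `(cx;q)_∞ = ∏_{j ≥ 0}(1 - cx q^j)`, as a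
formal power series in the power sums. -/
def prodSeries (a b qq : F) : MvPowerSeries ℕ F :=
  fun d => MvPolynomial.coeff d (prodComp a b qq (wt d))

/-- the formal (possibly infinite) sum `∑_i c_i g_i` of symmetric functions,
as a formal power series in the power sums. -/
def sumSeries {ι : Type*} (c : ι → F) (g : ι → Sym F) : MvPowerSeries ℕ F :=
  fun d => ∑ᶠ i : ι, c i * MvPolynomial.coeff d (g i)

/-- `ℚ(t)` -/
abbrev F1 : Type := RatFunc ℚ
/-- `ℚ(t)(q)` -/
abbrev F2 : Type := RatFunc F1
/-- `ℚ(t)(q)(a)` -/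
abbrev F3 : Type := RatFunc F2
/-- `ℚ(t)(q)(a)(b)` -/
abbrev F4 : Type := RatFunc F3

instance : Field F2 := inferInstance
instance : Field F3 := inferInstance
instance : Field F4 := inferInstance

/-- the indeterminate `t` in `ℚ(t)`. -/
def t1 : F1 := RatFunc.X
/-- the indeterminate `q` in `ℚ(t)(q)`. -/
def q2 : F2 := RatFunc.X
/-- the indeterminate `t` in `ℚ(t)(q)`. -/
def t2 : F2 := RatFunc.C t1
/-- the indeterminate `a` in `ℚ(t)(q)(a)`. -/
def a3 : F3 := RatFunc.X
/-- the indeterminate `q` in `ℚ(t)(q)(a)`. -/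
def q3 : F3 := RatFunc.C q2
/-- the indeterminate `t` in `ℚ(t)(q)(a)`. -/
def t3 : F3 := RatFunc.C t2
/-- the indeterminate `b` in `ℚ(t)(q)(a)(b)`. -/
def b4 : F4 := RatFunc.X
/-- the indeterminate `a` in `ℚ(t)(q)(a)(b)`. -/
def a4 : F4 := RatFunc.C a3
/-- the indeterminate `q` in `ℚ(t)(q)(a)(b)`. -/
def q4 : F4 := RatFunc.C q3
/-- the indeterminate `t` in `ℚ(t)(q)(a)(b)`. -/
def t4 : F4 := RatFunc.C t3


section PartA

/-- `g` is the formal exponential `exp (∑ a_i u^{i+1}/(i+1))`. -/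
def IsExp {R : Type*} [CommRing R] (a : ℕ → R) (g : PowerSeries R) : Prop :=
  PowerSeries.coeff 0 g = 1 ∧ ∀ n : ℕ, ((n : R) + 1) * PowerSeries.coeff (n + 1) g =
    ∑ ij ∈ Finset.HasAntidiagonal.antidiagonal n, a ij.1 * PowerSeries.coeff ij.2 g

variable {R S : Type*} [CommRing R] [CommRing S]

theorem isExp_iff (a : ℕ → R) (g : PowerSeries R) : IsExp a g ↔
    PowerSeries.coeff 0 g = 1 ∧ PowerSeries.derivative R g = PowerSeries.mk a * g := by
  unfold IsExp
  constructor
  · rintro ⟨h0, h⟩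
    refine ⟨h0, ?_⟩
    ext n
    rw [PowerSeries.coeff_derivative, PowerSeries.coeff_mul, mul_comm, h]
    simp
  · rintro ⟨h0, h⟩
    refine ⟨h0, fun n => ?_⟩
    have := congrArg (PowerSeries.coeff n) h
    rw [PowerSeries.coeff_derivative, PowerSeries.coeff_mul, mul_comm] at this
    rw [this]
    simp

theorem IsExp.unique [IsDomain R] [CharZero R] {a : ℕ → R} {g g' : PowerSeries R}
    (h : IsExp a g) (h' : IsExp a g') : g = g' := by
  ext n
  induction n using Nat.strong_induction_on with
  | _ n ih =>
    cases n with
    | zero => rw [h.1, h'.1]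
    | succ n =>
      have hn : ((n : R) + 1) ≠ 0 := by exact_mod_cast Nat.succ_ne_zero n
      apply mul_left_cancel₀ hn
      rw [h.2, h'.2]
      apply Finset.sum_congr rfl
      intro ij hij
      rw [ih ij.2 (by have := Finset.HasAntidiagonal.mem_antidiagonal.1 hij; omega)]

theorem IsExp.mul {a b : ℕ → R} {g g' : PowerSeries R}
    (h : IsExp a g) (h' : IsExp b g') : IsExp (fun i => a i + b i) (g * g') := by
  rw [isExp_iff] at *
  refine ⟨?_, ?_⟩
  · have h1 := h.1
    have h2 := h'.1
    simp only [PowerSeries.coeff_zero_eq_constantCoeff] at *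
    simp [h1, h2]
  · have : PowerSeries.mk (fun i => a i + b i) = PowerSeries.mk a + PowerSeries.mk b := by
      ext; simp
    rw [Derivation.leibniz, h.2, h'.2, this]
    simp only [smul_eq_mul]
    ring

theorem IsExp.map {a : ℕ → R} {g : PowerSeries R} (h : IsExp a g) (φ : R →+* S) :
    IsExp (fun i => φ (a i)) (PowerSeries.map φ g) := by
  refine ⟨by rw [PowerSeries.coeff_map, h.1, map_one], fun n => ?_⟩
  have := congrArg φ (h.2 n)
  simp only [PowerSeries.coeff_map]
  rw [map_mul, map_sum] at this
  simpa using this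

theorem IsExp.rescale {a : ℕ → R} {g : PowerSeries R} (h : IsExp a g) (s : R) :
    IsExp (fun i => s ^ (i + 1) * a i) (PowerSeries.rescale s g) := by
  refine ⟨by rw [PowerSeries.coeff_rescale, h.1]; simp, fun n => ?_⟩
  simp only [PowerSeries.coeff_rescale]
  rw [mul_left_comm, h.2, Finset.mul_sum]
  apply Finset.sum_congr rfl
  intro ij hij
  have := Finset.HasAntidiagonal.mem_antidiagonal.1 hij
  rw [← this]
  ring

theorem IsExp.zero : IsExp (fun _ => (0 : R)) 1 := by
  rw [isExp_iff]
  refine ⟨by simp, ?_⟩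
  have : PowerSeries.mk (fun _ => (0 : R)) = 0 := by ext; simp
  rw [this]; simp

theorem IsExp.lin (c : R) :
    IsExp (fun i => -c ^ (i + 1)) (1 - PowerSeries.C c * PowerSeries.X) := by
  rw [isExp_iff]
  refine ⟨by simp, ?_⟩
  ext n
  rw [mul_sub, mul_one, mul_left_comm]
  cases n with
  | zero => simp [PowerSeries.coeff_derivative, PowerSeries.coeff_one]
  | succ n => 
    simp [PowerSeries.coeff_derivative, PowerSeries.coeff_one, PowerSeries.coeff_X,
      PowerSeries.coeff_succ_mul_X, PowerSeries.coeff_C_mul]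
    ring

end PartA

section PartB

theorem Partition.ext' {a b : Partition} (h : ∀ i, a.part i = b.part i) : a = b := by
  cases a; cases b
  congr
  exact Finsupp.ext h

theorem Partition.exists_bound (a : Partition) : ∃ M, ∀ i, M ≤ i → a.part i = 0 := by
  refine ⟨a.part.support.sup id + 1, fun i hi => ?_⟩
  by_contra h
  have : id i ≤ a.part.support.sup id := Finset.le_sup (f := id) (Finsupp.mem_support_iff.2 h)
  simp at this
  omega

theorem lower_mem_iff (S : Finset ℕ) (h : ∀ i j, i ≤ j → j ∈ S → i ∈ S) (i : ℕ) :
    i < S.card ↔ i ∈ S := by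
  constructor
  · intro hi
    by_contra hc
    have : S ⊆ Finset.range i := by
      intro k hk
      rw [Finset.mem_range]
      by_contra hk'
      exact hc (h i k (by omega) hk)
    have := Finset.card_le_card this
    rw [Finset.card_range] at this
    omega
  · intro hi
    have : Finset.range (i + 1) ⊆ S := by
      intro k hk
      rw [Finset.mem_range] at hk
      exact h k i (by omega) hi
    have := Finset.card_le_card this
    rw [Finset.card_range] at this
    omega

theorem Partition.lt_conj_iff (a : Partition) (i j : ℕ) :
    i < a.conj (j + 1) ↔ j < a.part i := by
  unfold Partition.conj
  rw [lower_mem_iff]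
  · simp only [Finset.mem_filter, Finsupp.mem_support_iff]
    omega
  · intro k l hkl hl
    simp only [Finset.mem_filter, Finsupp.mem_support_iff] at hl ⊢
    have := a.antitone' hkl
    omega

/-- the conjugate partition -/
def Partition.T (a : Partition) : Partition where
  part := Finsupp.onFinset (Finset.range (a.part 0)) (fun i => a.conj (i + 1)) (by
    intro i hi
    rw [Finset.mem_range, ← a.lt_conj_iff]
    omega)
  antitone' := by
    intro i j hij
    simp only [Finsupp.onFinset_apply]
    by_contra h
    push Not at h
    have := (a.lt_conj_iff _ _).1 h
    have h2 : i < a.part (a.conj (i + 1)) := by omega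
    rw [← a.lt_conj_iff] at h2
    omega

theorem Partition.T_part (a : Partition) (i : ℕ) : a.T.part i = a.conj (i + 1) := by
  simp [Partition.T]

theorem Partition.lt_T_iff (a : Partition) (i j : ℕ) : i < a.T.part j ↔ j < a.part i := by
  rw [a.T_part, a.lt_conj_iff]

theorem Partition.T_T (a : Partition) : a.T.T = a := by
  apply Partition.ext'
  intro i
  have h : ∀ j, j < a.T.T.part i ↔ j < a.part i := by
    intro j
    rw [Partition.lt_T_iff, Partition.lt_T_iff]
  apply le_antisymm
  · by_contra hc
    push Not at hc
    have := (h _).1 hc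
    omega
  · by_contra hc
    push Not at hc
    have := (h _).2 hc
    omega

theorem Partition.T_bound (a : Partition) {i : ℕ} (hi : a.part 0 ≤ i) : a.T.part i = 0 := by
  by_contra h
  have : 0 < a.T.part i := by omega
  rw [a.lt_T_iff] at this
  omega

theorem Partition.size_eq (a : Partition) {M : ℕ} (h : ∀ i, M ≤ i → a.part i = 0) :
    a.size = ∑ i ∈ Finset.range M, a.part i := by
  unfold Partition.size
  apply Finsupp.sum_of_support_subset _ _ _ (by simp)
  intro i hi
  rw [Finset.mem_range]
  by_contra hc
  exact (Finsupp.mem_support_iff.1 hi) (h i (by omega))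

theorem Partition.nstat_eq (a : Partition) {M : ℕ} (h : ∀ i, M ≤ i → a.part i = 0) :
    a.nstat = ∑ i ∈ Finset.range M, i * a.part i := by
  unfold Partition.nstat
  apply Finsupp.sum_of_support_subset _ _ _ (by simp)
  intro i hi
  rw [Finset.mem_range]
  by_contra hc
  exact (Finsupp.mem_support_iff.1 hi) (h i (by omega))

theorem sum_ite_lt (n c : ℕ) (g : ℕ → ℕ) :
    (∑ j ∈ Finset.range n, if j < c then g j else 0) = ∑ j ∈ Finset.range (min c n), g j := by
  rw [← Finset.sum_filter]
  congr 1
  ext j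
  simp [and_comm]

theorem Partition.weighted_conj (a : Partition) (g : ℕ → ℕ) (k N : ℕ) (hN : a.part 0 ≤ N) :
    ∑ j ∈ Finset.range k, g j * a.part j =
      ∑ i ∈ Finset.range N, ∑ j ∈ Finset.range (min (a.T.part i) k), g j := by
  have h1 : ∀ j, g j * a.part j = ∑ i ∈ Finset.range N, if j < a.T.part i then g j else 0 := by
    intro j
    have : ∀ i, (if j < a.T.part i then g j else 0) = if i < a.part j then g j else 0 := by
      intro i
      simp only [a.lt_T_iff]
    simp only [this]
    rw [sum_ite_lt N (a.part j) (fun _ => g j)]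
    have := a.antitone' (Nat.zero_le j)
    rw [min_eq_left (by omega)]
    simp [mul_comm]
  simp only [h1]
  rw [Finset.sum_comm]
  apply Finset.sum_congr rfl
  intro i _
  rw [sum_ite_lt]

/-- partial row sums in terms of the columns -/
def psc (c : Partition) (k : ℕ) : ℕ := c.part.sum fun _ x => min x k

theorem psc_eq (c : Partition) (k : ℕ) {M : ℕ} (h : ∀ i, M ≤ i → c.part i = 0) :
    psc c k = ∑ i ∈ Finset.range M, min (c.part i) k := by
  unfold psc
  apply Finsupp.sum_of_support_subset _ _ _ (by simp)
  intro i hi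
  rw [Finset.mem_range]
  by_contra hc
  exact (Finsupp.mem_support_iff.1 hi) (h i (by omega))

theorem Partition.psum_eq (a : Partition) (k : ℕ) : a.psum k = psc a.T k := by
  have := a.weighted_conj (fun _ => 1) k (a.part 0) le_rfl
  rw [psc_eq a.T k (M := a.part 0) (fun i hi => a.T_bound hi)]
  unfold Partition.psum
  simpa using this

theorem Partition.part_le_size (a : Partition) (i : ℕ) : (i + 1) * a.part i ≤ a.size := by
  obtain ⟨M, hM⟩ := a.exists_bound
  rw [a.size_eq (M := M + i + 1) (fun j hj => hM j (by omega))]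
  calc (i + 1) * a.part i = ∑ j ∈ Finset.range (i + 1), a.part i := by simp
    _ ≤ ∑ j ∈ Finset.range (i + 1), a.part j := by
        apply Finset.sum_le_sum
        intro j hj
        rw [Finset.mem_range] at hj
        exact a.antitone' (by omega)
    _ ≤ _ := by
        apply Finset.sum_le_sum_of_subset
        intro j hj
        rw [Finset.mem_range] at *
        omega

theorem Partition.part_eq_zero (a : Partition) {i : ℕ} (h : a.size ≤ i) : a.part i = 0 := by
  have := a.part_le_size i
  by_contra hc
  have h1 : 1 ≤ a.part i := by omega
  nlinarith

theorem Partition.part_le (a : Partition) (i : ℕ) : a.part i ≤ a.size := by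
  have := a.part_le_size i
  nlinarith [Nat.zero_le (i * a.part i)]

theorem Partition.size_T (a : Partition) : a.T.size = a.size := by
  have h := a.weighted_conj (fun _ => 1) a.size (a.part 0) le_rfl
  rw [a.T.size_eq (M := a.part 0) (fun i hi => a.T_bound hi),
    a.size_eq (M := a.size) (fun i hi => a.part_eq_zero hi)]
  simp only [one_mul, Finset.sum_const, Finset.card_range, smul_eq_mul, mul_one] at h
  rw [h]
  apply Finset.sum_congr rfl
  intro i _
  rw [min_eq_left]
  by_contra hc
  push Not at hc
  rw [a.lt_T_iff, a.part_eq_zero le_rfl] at hc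
  omega

theorem Partition.nstat_T (a : Partition) {N : ℕ} (hN : a.part 0 ≤ N) :
    a.nstat = ∑ i ∈ Finset.range N, (a.T.part i).choose 2 := by
  have h := a.weighted_conj (fun j => j) a.size N hN
  rw [a.nstat_eq (M := a.size) (fun i hi => a.part_eq_zero hi), h]
  apply Finset.sum_congr rfl
  intro i _
  rw [min_eq_left]
  · rw [Finset.sum_range_id, Nat.choose_two_right]
  by_contra hc
  push Not at hc
  rw [a.lt_T_iff, a.part_eq_zero le_rfl] at hc
  omega

theorem finite_size (n : ℕ) : {a : Partition | a.size = n}.Finite := by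
  have hinj : Function.Injective Partition.part := by
    intro a b h
    apply Partition.ext'
    intro i
    rw [h]
  have : Set.Finite (Set.Iic (∑ i ∈ Finset.range n, Finsupp.single i n : ℕ →₀ ℕ)) :=
    Set.finite_Iic _
  apply Set.Finite.of_finite_image (f := Partition.part) _ hinj.injOn
  apply this.subset
  rintro _ ⟨a, ha, rfl⟩
  have ha : a.size = n := ha
  rw [Set.mem_Iic]
  intro i
  by_cases hi : i < n
  · have : (∑ i ∈ Finset.range n, Finsupp.single i n : ℕ →₀ ℕ) i = n := by
      rw [Finsupp.finset_sum_apply]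
      simp [Finsupp.single_apply, hi]
    rw [this, ← ha]
    exact a.part_le i
  · rw [a.part_eq_zero (by omega)]
    exact Nat.zero_le _

/-- the finite set of partitions of `n` -/
def pf (n : ℕ) : Finset Partition := (finite_size n).toFinset

theorem mem_pf {n : ℕ} {a : Partition} : a ∈ pf n ↔ a.size = n := by
  simp [pf]

/-! exponent vectors -/

/-- exponent vector of the power sum product -/
def mexp (a : Partition) : ℕ →₀ ℕ := ∑ j ∈ a.part.support, Finsupp.single (a.part j - 1) 1

theorem mexp_apply (a : Partition) (i : ℕ) : mexp a i = a.mult (i + 1) := by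
  unfold mexp Partition.mult
  rw [Finsupp.finset_sum_apply, Finset.card_filter]
  apply Finset.sum_congr rfl
  intro j hj
  rw [Finsupp.mem_support_iff] at hj
  rw [Finsupp.single_apply]
  congr 1
  apply propext
  omega

theorem conj_succ (a : Partition) (i : ℕ) : a.conj i = a.conj (i + 1) + a.mult i := by
  unfold Partition.conj Partition.mult
  rw [← Finset.card_union_of_disjoint]
  · congr 1
    ext j
    simp only [Finset.mem_filter, Finset.mem_union]
    rw [← and_or_left]
    apply and_congr_right
    intro _
    omega
  · rw [Finset.disjoint_filter]
    intro j _ h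
    omega

theorem mexp_inj {a b : Partition} (h : mexp a = mexp b) : a = b := by
  have hm : ∀ i, a.mult (i + 1) = b.mult (i + 1) := by
    intro i
    rw [← mexp_apply, ← mexp_apply, h]
  have hc : ∀ n i, a.part 0 + b.part 0 ≤ i + n → a.conj (i + 1) = b.conj (i + 1) := by
    intro n
    induction n with
    | zero =>
      intro i hi
      have h1 := a.T_bound (i := i) (by omega)
      have h2 := b.T_bound (i := i) (by omega)
      rw [Partition.T_part] at h1 h2
      omega
    | succ n ih =>
      intro i hi
      rw [conj_succ a, conj_succ b, hm, ih (i + 1) (by omega)]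
  rw [← a.T_T, ← b.T_T]
  congr 1
  apply Partition.ext'
  intro i
  rw [Partition.T_part, Partition.T_part]
  exact hc _ i (Nat.le_add_left _ _)

theorem mexp_surj (d : ℕ →₀ ℕ) : ∃ a : Partition, mexp a = d := by
  let c : Partition :=
    { part := Finsupp.onFinset (Finset.range (d.support.sup id + 1))
        (fun i => ∑ k ∈ d.support.filter (fun k => i ≤ k), d k) (by
          intro i hi
          rw [Finset.mem_range]
          by_contra hc
          apply hi
          apply Finset.sum_eq_zero
          intro k hk
          rw [Finset.mem_filter] at hk
          have : id k ≤ d.support.sup id := Finset.le_sup (f := id) hk.1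
          simp only [id] at this
          omega)
      antitone' := by
        intro i j hij
        simp only [Finsupp.onFinset_apply]
        apply Finset.sum_le_sum_of_subset
        intro k hk
        rw [Finset.mem_filter] at *
        exact ⟨hk.1, by omega⟩ }
  refine ⟨c.T, ?_⟩
  ext i
  rw [mexp_apply]
  have h1 := conj_succ c.T (i + 1)
  rw [← Partition.T_part, ← Partition.T_part, c.T_T] at h1
  have h2 : c.part i = c.part (i + 1) + d i := by
    simp only [c, Finsupp.onFinset_apply]
    by_cases hi : i ∈ d.support
    · have : d.support.filter (fun k => i ≤ k)
          = insert i (d.support.filter (fun k => i + 1 ≤ k)) := by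
        ext k
        simp only [Finset.mem_filter, Finset.mem_insert]
        constructor
        · rintro ⟨h, h'⟩
          by_cases hk : k = i
          · exact Or.inl hk
          · exact Or.inr ⟨h, by omega⟩
        · rintro (rfl | ⟨h, h'⟩)
          · exact ⟨hi, le_rfl⟩
          · exact ⟨h, by omega⟩
      rw [this, Finset.sum_insert (by simp), add_comm]
    · have : d.support.filter (fun k => i ≤ k) = d.support.filter (fun k => i + 1 ≤ k) := by
        ext k
        simp only [Finset.mem_filter]
        constructor
        · rintro ⟨h, h'⟩
          refine ⟨h, ?_⟩
          rcases Nat.lt_or_ge i k with h1 | h1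
          · omega
          · exfalso; apply hi; have : i = k := by omega
            rw [this]; exact h
        · rintro ⟨h, h'⟩
          exact ⟨h, by omega⟩
      rw [this, Finsupp.notMem_support_iff.1 hi, add_zero]
  omega

theorem wt_add (d e : ℕ →₀ ℕ) : wt (d + e) = wt d + wt e := by
  unfold wt
  rw [Finsupp.sum_add_index']
  · simp
  · intros; ring

theorem wt_single (i m : ℕ) : wt (Finsupp.single i m) = (i + 1) * m := by
  unfold wt
  rw [Finsupp.sum_single_index]
  simp

theorem wt_mexp (a : Partition) : wt (mexp a) = a.size := by
  have h : ∀ (s : Finset ℕ) (f : ℕ → ℕ →₀ ℕ), wt (∑ j ∈ s, f j) = ∑ j ∈ s, wt (f j) := by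
    intro s f
    classical
    induction s using Finset.induction_on with
    | empty => simp [wt]
    | insert x s hx ih => rw [Finset.sum_insert hx, Finset.sum_insert hx, wt_add, ih]
  unfold mexp Partition.size
  rw [h, Finsupp.sum]
  apply Finset.sum_congr rfl
  intro j hj
  rw [Finsupp.mem_support_iff] at hj
  rw [wt_single]
  omega

/-- `z` of an exponent vector -/
def zd (F : Type*) [Field F] (d : ℕ →₀ ℕ) : F :=
  d.prod fun n m => ((n : F) + 1) ^ m * (Nat.factorial m : F)

theorem prod_Icc_one (n : ℕ) (f : ℕ → F) :
    ∏ r ∈ Finset.Icc 1 n, f r = ∏ i ∈ Finset.range n, f (i + 1) := by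
  induction n with
  | zero => simp
  | succ n ih => rw [Finset.prod_range_succ, ← ih, Finset.prod_Icc_succ_top (by omega)]

theorem zee_eq (a : Partition) : (a.zee : F) = zd F (mexp a) := by
  unfold zd Partition.zee
  rw [Finsupp.prod_of_support_subset (s := Finset.range (a.part 0))]
  · push_cast
    rw [prod_Icc_one]
    apply Finset.prod_congr rfl
    intro i _
    rw [mexp_apply]
    push_cast
    rfl
  · intro i hi
    rw [Finsupp.mem_support_iff, mexp_apply] at hi
    rw [Finset.mem_range]
    have h1 := conj_succ a (i + 1)
    by_contra hc
    have := a.T_bound (i := i) (by omega)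
    rw [a.T_part] at this
    omega
  · intro i _
    simp

theorem pprod_eq (a : Partition) : (pprod a : Sym F) = MvPolynomial.monomial (mexp a) 1 := by
  unfold pprod mexp
  rw [MvPolynomial.monomial_sum_one]
  rfl

theorem zd_ne_zero [CharZero F] (d : ℕ →₀ ℕ) : zd F d ≠ 0 := by
  unfold zd Finsupp.prod
  rw [Finset.prod_ne_zero_iff]
  intro i _
  apply mul_ne_zero
  · exact pow_ne_zero _ (by exact_mod_cast Nat.succ_ne_zero i)
  · exact_mod_cast Nat.factorial_ne_zero _

theorem coeff_hsym (r : ℕ) (d : ℕ →₀ ℕ) :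
    MvPolynomial.coeff d (hsym F r) = if wt d = r then (zd F d)⁻¹ else 0 := by
  have h : hsym F r = ∑ k ∈ pf r, ((k.zee : F))⁻¹ • (pprod k : Sym F) := by
    unfold hsym
    rw [← finsum_mem_finset_eq_sum]
    apply finsum_congr
    intro k
    exact finsum_congr_Prop (propext mem_pf).symm (fun _ => rfl)
  rw [h, MvPolynomial.coeff_sum]
  simp only [MvPolynomial.coeff_smul, pprod_eq, MvPolynomial.coeff_monomial, zee_eq, smul_eq_mul,
    mul_ite, mul_one, mul_zero]
  split_ifs with hd
  · obtain ⟨a, rfl⟩ := mexp_surj d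
    rw [Finset.sum_eq_single a]
    · simp
    · intro b _ hb
      rw [if_neg]
      intro h
      exact hb (mexp_inj h)
    · intro ha
      rw [mem_pf, ← wt_mexp] at ha
      exact absurd hd ha
  · apply Finset.sum_eq_zero
    intro k hk
    rw [if_neg]
    rintro rfl
    rw [wt_mexp] at hd
    rw [mem_pf] at hk
    exact hd hk

end PartB

section PartC

theorem zd_add_single (e : ℕ →₀ ℕ) (i : ℕ) :
    zd F (e + Finsupp.single i 1) = ((i : F) + 1) * ((e i : F) + 1) * zd F e := by
  unfold zd
  rw [← Finsupp.mul_prod_erase' _ i _ (by simp), ← Finsupp.mul_prod_erase' e i _ (by simp)]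
  have : (e + Finsupp.single i 1).erase i = e.erase i := by
    ext j
    by_cases h : j = i
    · simp [h]
    · rw [Finsupp.erase_ne h, Finsupp.erase_ne h]
      simp [Finsupp.single_apply, Ne.symm h]
  rw [this]
  simp only [Finsupp.add_apply, Finsupp.single_eq_same, Nat.factorial_succ, pow_succ]
  push_cast
  ring

/-- the complete homogeneous series -/
def hser (F : Type*) [Field F] : PowerSeries (Sym F) := PowerSeries.mk (hsym F)

theorem wt_eq_sum (d : ℕ →₀ ℕ) (n : ℕ) (h : wt d ≤ n) :
    wt d = ∑ i ∈ Finset.range n, (i + 1) * d i := by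
  unfold wt
  rw [Finsupp.sum_of_support_subset]
  · intro i hi
    rw [Finset.mem_range]
    rw [Finsupp.mem_support_iff] at hi
    have : (i + 1) * d i ≤ wt d := by
      unfold wt Finsupp.sum
      exact Finset.single_le_sum (f := fun i => (i + 1) * d i) (fun _ _ => Nat.zero_le _)
        (Finsupp.mem_support_iff.2 hi)
    have h1 : 1 ≤ d i := by omega
    nlinarith
  · simp

theorem isExp_hser [CharZero F] : IsExp (fun i => (MvPolynomial.X i : Sym F)) (hser F) := by
  refine ⟨?_, fun n => ?_⟩
  · rw [hser, PowerSeries.coeff_mk]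
    ext d
    rw [coeff_hsym, MvPolynomial.coeff_one]
    by_cases h : d = 0
    · subst h; simp [wt, zd]
    · rw [if_neg, if_neg (Ne.symm h)]
      intro hw
      apply h
      have := wt_eq_sum d 0 (by omega)
      ext i
      by_contra hi
      have h2 : (i + 1) * d i ≤ wt d := by
        unfold wt Finsupp.sum
        exact Finset.single_le_sum (f := fun i => (i + 1) * d i) (fun _ _ => Nat.zero_le _)
          (Finsupp.mem_support_iff.2 hi)
      have h3 : 1 ≤ d i := Nat.one_le_iff_ne_zero.2 hi
      nlinarith
  · simp only [hser, PowerSeries.coeff_mk]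
    ext d
    rw [MvPolynomial.coeff_sum, Finset.Nat.sum_antidiagonal_eq_sum_range_succ
      (f := fun i j => MvPolynomial.coeff d (MvPolynomial.X i * hsym F j))]
    have e1 : ((n : Sym F) + 1) = MvPolynomial.C ((n : F) + 1) := by simp
    rw [e1, MvPolynomial.coeff_C_mul, coeff_hsym]
    have key : ∀ i ∈ Finset.range n.succ, MvPolynomial.coeff d (MvPolynomial.X i * hsym F (n - i))
        = if wt d = n + 1 then ((i : F) + 1) * (d i) * (zd F d)⁻¹ else 0 := by
      intro i hi
      rw [Finset.mem_range] at hi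
      rw [MvPolynomial.coeff_X_mul']
      split_ifs with h1 h2 h2
      · obtain ⟨e, rfl⟩ : ∃ e, d = e + Finsupp.single i 1 := by
          refine ⟨d - Finsupp.single i 1, ?_⟩
          rw [Finsupp.mem_support_iff] at h1
          ext j
          simp only [Finsupp.add_apply, Finsupp.tsub_apply, Finsupp.single_apply]
          split_ifs with hj
          · subst hj; omega
          · omega
        rw [add_tsub_cancel_right, coeff_hsym, if_pos, zd_add_single]
        · have := zd_ne_zero (F := F) e
          have h4 : ((i : F) + 1) ≠ 0 := by exact_mod_cast Nat.succ_ne_zero i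
          have h5 : ((e i : F) + 1) ≠ 0 := by exact_mod_cast Nat.succ_ne_zero (e i)
          simp only [Finsupp.add_apply, Finsupp.single_eq_same]
          push_cast
          field_simp
        · rw [wt_add, wt_single] at h2
          omega
      · obtain ⟨e, rfl⟩ : ∃ e, d = e + Finsupp.single i 1 := by
          refine ⟨d - Finsupp.single i 1, ?_⟩
          rw [Finsupp.mem_support_iff] at h1
          ext j
          simp only [Finsupp.add_apply, Finsupp.tsub_apply, Finsupp.single_apply]
          split_ifs with hj
          · subst hj; omega
          · omega
        rw [add_tsub_cancel_right, coeff_hsym, if_neg]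
        rw [wt_add, wt_single] at h2
        omega
      · rw [Finsupp.notMem_support_iff] at h1
        simp [h1]
      · rfl
    rw [Finset.sum_congr rfl key]
    split_ifs with h
    · rw [← Finset.sum_mul]
      congr 1
      have := wt_eq_sum d (n + 1) (by omega)
      have h2 : ((wt d : ℕ) : F) = ∑ i ∈ Finset.range (n + 1), ((i : F) + 1) * d i := by
        rw [this]; push_cast; rfl
      rw [← h2, h]; push_cast; rfl
    · simp

/-- scaling of the power sums -/
def scal (s : ℕ → F) : Sym F →ₐ[F] Sym F :=
  MvPolynomial.aeval (fun n => MvPolynomial.C (s n) * MvPolynomial.X n)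

theorem coeff_scal (s : ℕ → F) (f : Sym F) (d : ℕ →₀ ℕ) :
    MvPolynomial.coeff d (scal s f) = (d.prod fun n m => s n ^ m) * MvPolynomial.coeff d f := by
  induction f using MvPolynomial.induction_on' with
  | monomial e a =>
    have : scal s (MvPolynomial.monomial e a) =
        MvPolynomial.monomial e (a * (e.prod fun n m => s n ^ m)) := by
      unfold scal
      rw [MvPolynomial.aeval_monomial]
      simp only [mul_pow, Finsupp.prod_mul]
      rw [MvPolynomial.monomial_eq (s := e) (a := _ * _)]
      simp only [MvPolynomial.algebraMap_eq, Finsupp.prod, map_mul, map_prod, map_pow]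
      ring
    rw [this, MvPolynomial.coeff_monomial, MvPolynomial.coeff_monomial]
    split_ifs with h
    · subst h; ring
    · simp
  | add p q hp hq => rw [map_add, MvPolynomial.coeff_add, hp, hq, MvPolynomial.coeff_add]; ring

theorem scal_X (s : ℕ → F) (n : ℕ) :
    scal s (MvPolynomial.X n) = MvPolynomial.C (s n) * MvPolynomial.X n := by
  simp [scal]

/-- signed elementary symmetric functions -/
def ets (F : Type*) [Field F] (r : ℕ) : Sym F := scal (fun _ => -1) (hsym F r)

/-- Hall--Littlewood one-row functions -/
def qsym (t : F) (r : ℕ) : Sym F := scal (fun n => 1 - t ^ (n + 1)) (hsym F r)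

theorem isExp_ets [CharZero F] :
    IsExp (fun i => -(MvPolynomial.X i : Sym F)) (PowerSeries.mk (ets F)) := by
  have := (isExp_hser (F := F)).map (scal (fun _ => (-1 : F))).toRingHom
  convert this using 2
  · simp [scal_X]
  · ext n; simp [hser, ets, qsym]

theorem isExp_qsym [CharZero F] (t : F) :
    IsExp (fun i => (1 - MvPolynomial.C t ^ (i + 1)) * (MvPolynomial.X i : Sym F))
      (PowerSeries.mk (qsym t)) := by
  have := (isExp_hser (F := F)).map (scal (fun n => 1 - t ^ (n + 1))).toRingHom
  convert this using 2
  · simp [scal_X]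
  · ext n; simp [hser, ets, qsym]

/-- weighted diagonal pairing, on a set -/
def pr0 (w : (ℕ →₀ ℕ) → F) (f g : Sym F) : F :=
  ∑ d ∈ f.support, f.coeff d * g.coeff d * w d

theorem pr0_eq (w : (ℕ →₀ ℕ) → F) (f g : Sym F) (s : Finset (ℕ →₀ ℕ)) (h : f.support ⊆ s) :
    pr0 w f g = ∑ d ∈ s, f.coeff d * g.coeff d * w d := by
  unfold pr0
  apply Finset.sum_subset h
  intro d _ hd
  rw [MvPolynomial.notMem_support_iff.1 hd]
  ring

/-- weighted diagonal pairing -/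
def pr (w : (ℕ →₀ ℕ) → F) : Sym F →ₗ[F] Sym F →ₗ[F] F :=
  LinearMap.mk₂ F (pr0 w)
    (by
      intro f f' g
      classical
      rw [pr0_eq w (f + f') g (f.support ∪ f'.support) MvPolynomial.support_add,
        pr0_eq w f g _ Finset.subset_union_left, pr0_eq w f' g _ Finset.subset_union_right,
        ← Finset.sum_add_distrib]
      refine Finset.sum_congr rfl fun d _ => ?_
      rw [MvPolynomial.coeff_add]; ring)
    (by
      intro c f g
      rw [pr0_eq w (c • f) g f.support MvPolynomial.support_smul]
      unfold pr0
      rw [smul_eq_mul, Finset.mul_sum]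
      refine Finset.sum_congr rfl fun d _ => ?_
      rw [MvPolynomial.coeff_smul, smul_eq_mul]; ring)
    (by
      intro f g g'
      unfold pr0
      rw [← Finset.sum_add_distrib]
      refine Finset.sum_congr rfl fun d _ => ?_
      rw [MvPolynomial.coeff_add]; ring)
    (by
      intro c f g
      unfold pr0
      rw [smul_eq_mul, Finset.mul_sum]
      refine Finset.sum_congr rfl fun d _ => ?_
      rw [MvPolynomial.coeff_smul, smul_eq_mul]; ring)

theorem pr_apply (w : (ℕ →₀ ℕ) → F) (f g : Sym F) : pr w f g = pr0 w f g := rfl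

theorem pr_comm (w : (ℕ →₀ ℕ) → F) (f g : Sym F) : pr w f g = pr w g f := by
  classical
  rw [pr_apply, pr_apply, pr0_eq w f g (f.support ∪ g.support) Finset.subset_union_left,
    pr0_eq w g f (f.support ∪ g.support) Finset.subset_union_right]
  refine Finset.sum_congr rfl fun d _ => ?_
  ring

theorem pr_monomial (w : (ℕ →₀ ℕ) → F) (d : ℕ →₀ ℕ) (a : F) (g : Sym F) :
    pr w (MvPolynomial.monomial d a) g = a * g.coeff d * w d := by
  classical
  rw [pr_apply, pr0_eq w _ g {d} MvPolynomial.support_monomial_subset]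
  simp

theorem pr_nondeg (w : (ℕ →₀ ℕ) → F) (hw : ∀ d, w d ≠ 0) (f : Sym F)
    (h : ∀ g, pr w f g = 0) : f = 0 := by
  ext d
  have := h (MvPolynomial.monomial d 1)
  rw [pr_comm, pr_monomial, one_mul] at this
  simpa [hw d] using this

/-- the Hall pairing -/
abbrev hall (F : Type*) [Field F] : Sym F →ₗ[F] Sym F →ₗ[F] F := pr (zd F)

/-- the Hall--Littlewood weight -/
def wq (t : F) (d : ℕ →₀ ℕ) : F := zd F d * d.prod fun n m => ((1 - t ^ (n + 1))⁻¹) ^ m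

/-- the Hall--Littlewood pairing -/
abbrev hl (t : F) : Sym F →ₗ[F] Sym F →ₗ[F] F := pr (wq t)

theorem innerQT_tt (t : F) (ht : ∀ n : ℕ, t ^ (n + 1) ≠ 1) (f g : Sym F) :
    innerQT t t f g = hall F f g := by
  rw [pr_apply]
  unfold innerQT pr0
  refine Finset.sum_congr rfl fun d _ => ?_
  congr 1
  unfold zd
  refine Finset.prod_congr rfl fun n _ => ?_
  dsimp only
  rw [div_self (sub_ne_zero.2 (ht n).symm)]
  simp

theorem innerQT_zero (t : F) (f g : Sym F) :
    innerQT 0 t f g = hl t f g := by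
  rw [pr_apply]
  unfold innerQT pr0
  refine Finset.sum_congr rfl fun d _ => ?_
  congr 1
  unfold wq zd
  rw [← Finsupp.prod_mul]
  refine Finset.prod_congr rfl fun n _ => ?_
  simp

theorem wq_ne_zero [CharZero F] (t : F) (ht : ∀ n : ℕ, t ^ (n + 1) ≠ 1) (d : ℕ →₀ ℕ) :
    wq t d ≠ 0 := by
  unfold wq
  apply mul_ne_zero (zd_ne_zero d)
  unfold Finsupp.prod
  rw [Finset.prod_ne_zero_iff]
  intro n _
  exact pow_ne_zero _ (inv_ne_zero (sub_ne_zero.2 (ht n).symm))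

theorem hl_scal (t : F) (ht : ∀ n : ℕ, t ^ (n + 1) ≠ 1) (f g : Sym F) :
    hl t f (scal (fun n => 1 - t ^ (n + 1)) g) = hall F f g := by
  rw [pr_apply, pr_apply]
  unfold pr0
  refine Finset.sum_congr rfl fun d _ => ?_
  rw [coeff_scal]
  unfold wq
  have : (d.prod fun n m => (1 - t ^ (n + 1)) ^ m) *
      (d.prod fun n m => ((1 - t ^ (n + 1))⁻¹) ^ m) = 1 := by
    rw [← Finsupp.prod_mul]
    apply Finset.prod_eq_one
    intro n _
    dsimp only
    rw [← mul_pow, mul_inv_cancel₀ (sub_ne_zero.2 (ht n).symm), one_pow]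
  linear_combination (MvPolynomial.coeff d f * MvPolynomial.coeff d g * zd F d) * this

theorem hall_X_mul (n : ℕ) (f g : Sym F) :
    hall F (MvPolynomial.X n * f) g = ((n : F) + 1) * hall F f (MvPolynomial.pderiv n g) := by
  induction f using MvPolynomial.induction_on' with
  | monomial d a =>
    have : (MvPolynomial.X n * MvPolynomial.monomial d a : Sym F) =
        MvPolynomial.monomial (d + Finsupp.single n 1) a := by
      rw [MvPolynomial.X, MvPolynomial.monomial_mul, one_mul, add_comm]
    rw [this, pr_monomial, pr_monomial, zd_add_single, MvPolynomial.coeff_pderiv]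
    ring
  | add p q hp hq =>
    rw [mul_add, map_add, LinearMap.add_apply, hp, hq, map_add, LinearMap.add_apply]; ring

theorem coeff_ets (r : ℕ) (d : ℕ →₀ ℕ) : MvPolynomial.coeff d (ets F r) =
    if wt d = r then (d.prod fun _ m => (-1 : F) ^ m) * (zd F d)⁻¹ else 0 := by
  rw [ets, coeff_scal, coeff_hsym]
  split_ifs <;> simp

theorem pderiv_ets [CharZero F] (n r : ℕ) :
    ((n : F) + 1) • MvPolynomial.pderiv n (ets F r) =
      if n + 1 ≤ r then - ets F (r - (n + 1)) else 0 := by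
  ext d
  rw [MvPolynomial.coeff_smul, MvPolynomial.coeff_pderiv, coeff_ets, wt_add, wt_single,
    zd_add_single]
  have h4 : ((n : F) + 1) ≠ 0 := by exact_mod_cast Nat.succ_ne_zero n
  have h5 : ((d n : F) + 1) ≠ 0 := by exact_mod_cast Nat.succ_ne_zero (d n)
  have h6 := zd_ne_zero (F := F) d
  have h7 : ((d + Finsupp.single n 1).prod fun _ m => (-1 : F) ^ m) =
      - (d.prod fun _ m => (-1 : F) ^ m) := by
    rw [Finsupp.prod_add_index' (by simp) (by intros; rw [pow_add]),
      Finsupp.prod_single_index (by simp)]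
    ring
  rw [h7]
  by_cases h : n + 1 ≤ r
  · rw [if_pos h, MvPolynomial.coeff_neg, coeff_ets]
    by_cases h2 : wt d = r - (n + 1)
    · rw [if_pos h2, if_pos (by omega), smul_eq_mul]
      field_simp
    · rw [if_neg h2, if_neg (by omega)]
      simp
  · rw [if_neg h, if_neg (by omega)]
    simp

end PartC

section PartD

/-- the translation homomorphism -/
def Dh (F : Type*) [Field F] : Sym F →ₐ[F] Polynomial (Sym F) :=
  MvPolynomial.aeval (fun n => Polynomial.C (MvPolynomial.X n) - Polynomial.X ^ (n + 1))

theorem Dh_X (n : ℕ) : Dh F (MvPolynomial.X n) =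
    Polynomial.C (MvPolynomial.X n) - Polynomial.X ^ (n + 1) := by
  simp [Dh]

theorem Dh_C (a : F) : Dh F (MvPolynomial.C a) = Polynomial.C (MvPolynomial.C a) := by
  rw [Dh, MvPolynomial.aeval_C]; rfl

/-- coefficients of the translation homomorphism -/
def Dk (k : ℕ) (f : Sym F) : Sym F := (Dh F f).coeff k

theorem Dk_add (k : ℕ) (f g : Sym F) : Dk k (f + g) = Dk k f + Dk k g := by
  simp [Dk]

theorem Dk_sub (k : ℕ) (f g : Sym F) : Dk k (f - g) = Dk k f - Dk k g := by
  simp [Dk]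

theorem Dk_C (k : ℕ) (a : F) : Dk k (MvPolynomial.C a) = if k = 0 then MvPolynomial.C a else 0 := by
  rw [Dk, Dh_C, Polynomial.coeff_C]

theorem Dk_X_mul (k n : ℕ) (f : Sym F) : Dk k (MvPolynomial.X n * f) =
    MvPolynomial.X n * Dk k f - if n + 1 ≤ k then Dk (k - (n + 1)) f else 0 := by
  rw [Dk, map_mul, Dh_X, sub_mul, Polynomial.coeff_sub, Polynomial.coeff_C_mul,
    Polynomial.coeff_X_pow_mul']
  rfl

theorem Dk_comm (f : Sym F) : ∀ k l : ℕ, Dk k (Dk l f) = Dk l (Dk k f) := by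
  induction f using MvPolynomial.induction_on with
  | C a =>
    intro k l
    have h0 : ∀ j, Dk j (0 : Sym F) = 0 := by intro j; simp [Dk]
    simp only [Dk_C]
    by_cases hk : k = 0 <;> by_cases hl : l = 0 <;> simp [hk, hl, h0, Dk_C]
  | add p q hp hq => intro k l; simp only [Dk_add, hp, hq]
  | mul_X p n hp =>
    intro k l
    have h0 : ∀ j, Dk j (0 : Sym F) = 0 := by intro j; simp [Dk]
    rw [mul_comm]
    have key : ∀ k l, Dk k (Dk l (MvPolynomial.X n * p)) =
        MvPolynomial.X n * Dk k (Dk l p) - (if n + 1 ≤ k then Dk (k - (n + 1)) (Dk l p) else 0)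
        - (if n + 1 ≤ l then Dk k (Dk (l - (n + 1)) p) else 0) := by
      intro k l
      rw [Dk_X_mul, Dk_sub, Dk_X_mul]
      split_ifs <;> simp [h0]
    rw [key, key, hp k l]
    have e1 : (if n + 1 ≤ k then Dk (k - (n + 1)) (Dk l p) else 0) =
        (if n + 1 ≤ k then Dk l (Dk (k - (n + 1)) p) else 0) := by rw [hp]
    have e2 : (if n + 1 ≤ l then Dk (l - (n + 1)) (Dk k p) else 0) =
        (if n + 1 ≤ l then Dk k (Dk (l - (n + 1)) p) else 0) := by rw [hp]
    rw [e1, e2]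
    ring

theorem mapD_h [CharZero F] : PowerSeries.map (Dh F).toRingHom (hser F) =
    PowerSeries.map (Polynomial.C) (hser F) *
      (1 - PowerSeries.C (Polynomial.X) * PowerSeries.X) := by
  apply ((isExp_hser (F := F)).map (Dh F).toRingHom).unique
  convert ((isExp_hser (F := F)).map (Polynomial.C)).mul (IsExp.lin Polynomial.X) using 2
  rw [← sub_eq_add_neg]
  exact Dh_X _

theorem mapD_e [CharZero F] : PowerSeries.map (Dh F).toRingHom (PowerSeries.mk (ets F)) *
      (1 - PowerSeries.C (Polynomial.X) * PowerSeries.X) =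
    PowerSeries.map (Polynomial.C) (PowerSeries.mk (ets F)) := by
  refine IsExp.unique (a := fun i => Polynomial.C (-(MvPolynomial.X i : Sym F))) ?_
    ((isExp_ets (F := F)).map _)
  convert ((isExp_ets (F := F)).map (Dh F).toRingHom).mul (IsExp.lin Polynomial.X) using 2 with i
  have : (Dh F).toRingHom (-MvPolynomial.X i) = -(Dh F (MvPolynomial.X i)) := by simp
  rw [this, Dh_X, map_neg]
  ring

theorem mapD_q [CharZero F] (t : F) : PowerSeries.map (Dh F).toRingHom (PowerSeries.mk (qsym t)) *
      (1 - PowerSeries.C (Polynomial.C (MvPolynomial.C t) * Polynomial.X) * PowerSeries.X) =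
    PowerSeries.map (Polynomial.C) (PowerSeries.mk (qsym t)) *
      (1 - PowerSeries.C (Polynomial.X) * PowerSeries.X) := by
  apply IsExp.unique (((isExp_qsym t).map (Dh F).toRingHom).mul (IsExp.lin _))
  convert ((isExp_qsym t).map (Polynomial.C)).mul (IsExp.lin Polynomial.X) using 2 with i
  have : (Dh F).toRingHom ((1 - MvPolynomial.C t ^ (i + 1)) * MvPolynomial.X i) =
    (1 - Dh F (MvPolynomial.C t) ^ (i + 1)) * (Dh F (MvPolynomial.X i)) := by simp
  rw [this, Dh_X, Dh_C]
  simp only [map_mul, map_sub, map_pow, map_one]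
  ring

theorem hsym_zero [CharZero F] : hsym F 0 = 1 := by
  have := (isExp_hser (F := F)).1
  rwa [hser, PowerSeries.coeff_mk] at this

theorem ets_zero [CharZero F] : ets F 0 = 1 := by
  rw [ets, hsym_zero, map_one]

theorem qsym_zero [CharZero F] (t : F) : qsym t 0 = 1 := by
  rw [qsym, hsym_zero, map_one]

theorem coeff_lin {R : Type*} [CommRing R] (g : PowerSeries R) (c : R) (n : ℕ) :
    PowerSeries.coeff (n + 1) (g * (1 - PowerSeries.C c * PowerSeries.X)) =
      PowerSeries.coeff (n + 1) g - c * PowerSeries.coeff n g := by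
  rw [mul_sub, mul_one, map_sub]
  congr 1
  rw [← mul_assoc, PowerSeries.coeff_succ_mul_X, mul_comm, PowerSeries.coeff_C_mul]

theorem Dh_h [CharZero F] (r : ℕ) : Dh F (hsym F (r + 1)) =
    Polynomial.C (hsym F (r + 1)) - Polynomial.X * Polynomial.C (hsym F r) := by
  have := congrArg (PowerSeries.coeff (r + 1)) (mapD_h (F := F))
  rw [coeff_lin] at this
  simpa [hser] using this

theorem Dh_e [CharZero F] (r : ℕ) : Dh F (ets F (r + 1)) - Polynomial.X * Dh F (ets F r) =
    Polynomial.C (ets F (r + 1)) := by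
  have := congrArg (PowerSeries.coeff (r + 1)) (mapD_e (F := F))
  rw [coeff_lin] at this
  simpa using this

theorem Dh_q [CharZero F] (t : F) (r : ℕ) : Dh F (qsym t (r + 1)) -
      Polynomial.C (MvPolynomial.C t) * Polynomial.X * Dh F (qsym t r) =
    Polynomial.C (qsym t (r + 1)) - Polynomial.X * Polynomial.C (qsym t r) := by
  have := congrArg (PowerSeries.coeff (r + 1)) (mapD_q t)
  rw [coeff_lin, coeff_lin] at this
  simpa using this

/-- evaluation of a polynomial against shifted one-row functions -/
def Psi (t : F) (a : ℕ) : Polynomial (Sym F) →ₗ[Sym F] Sym F :=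
  Polynomial.lsum fun k => (qsym t (a + k)) • LinearMap.id

theorem Psi_monomial (t : F) (a k : ℕ) (x : Sym F) :
    Psi t a (Polynomial.monomial k x) = qsym t (a + k) * x := by
  simp [Psi]

theorem Psi_C_mul (t : F) (a : ℕ) (x : Sym F) (φ : Polynomial (Sym F)) :
    Psi t a (Polynomial.C x * φ) = x * Psi t a φ := by
  rw [← Polynomial.smul_eq_C_mul, map_smul, smul_eq_mul]

theorem Psi_X_mul (t : F) (a : ℕ) (φ : Polynomial (Sym F)) :
    Psi t a (Polynomial.X * φ) = Psi t (a + 1) φ := by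
  induction φ using Polynomial.induction_on' with
  | add p q hp hq => rw [mul_add, map_add, hp, hq, map_add]
  | monomial n x =>
    rw [Polynomial.X_mul_monomial, Psi_monomial, Psi_monomial]
    congr 2
    ring

theorem Psi_eq (t : F) (a : ℕ) (φ : Polynomial (Sym F)) (N : ℕ) (h : ∀ k, N ≤ k → φ.coeff k = 0) :
    Psi t a φ = ∑ k ∈ Finset.range N, qsym t (a + k) * φ.coeff k := by
  have : φ = ∑ k ∈ Finset.range N, Polynomial.monomial k (φ.coeff k) := by
    ext1 k
    rw [Polynomial.finsetSum_coeff]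
    simp only [Polynomial.coeff_monomial]
    rw [Finset.sum_ite_eq']
    split_ifs with h1
    · rfl
    · exact h k (by simpa using h1)
  conv_lhs => rw [this]
  rw [map_sum]
  simp only [Psi_monomial]

/-- vertex operator -/
def Hop (t : F) (a : ℕ) : Module.End F (Sym F) :=
  ((Psi t a).restrictScalars F) ∘ₗ (Dh F).toLinearMap

theorem Hop_apply (t : F) (a : ℕ) (f : Sym F) : Hop t a f = Psi t a (Dh F f) := rfl

theorem Hop_e [CharZero F] (t : F) (a r : ℕ) (f : Sym F) :
    Hop t a (ets F (r + 1) * f) = ets F (r + 1) * Hop t a f + Hop t (a + 1) (ets F r * f) := by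
  rw [Hop_apply, map_mul, sub_eq_iff_eq_add.1 (Dh_e r), add_mul, map_add, Psi_C_mul, mul_assoc,
    Psi_X_mul, ← map_mul]
  rfl

theorem Hop_q [CharZero F] (t : F) (a r : ℕ) (f : Sym F) :
    Hop t a (qsym t (r + 1) * f) = t • Hop t (a + 1) (qsym t r * f) +
      qsym t (r + 1) * Hop t a f - qsym t r * Hop t (a + 1) f := by
  have h : Dh F (qsym t (r + 1) * f) = Polynomial.C (MvPolynomial.C t) *
      (Polynomial.X * Dh F (qsym t r * f)) + Polynomial.C (qsym t (r + 1)) * Dh F f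
      - Polynomial.C (qsym t r) * (Polynomial.X * Dh F f) := by
    rw [map_mul, map_mul, sub_eq_iff_eq_add.1 (Dh_q t r)]
    ring
  rw [Hop_apply, h, map_sub, map_add, Psi_C_mul, Psi_X_mul, Psi_C_mul, Psi_C_mul, Psi_X_mul,
    ← MvPolynomial.smul_eq_C_mul]
  rfl

theorem Hop_eq (t : F) (a : ℕ) (f : Sym F) (N : ℕ) (h : ∀ k, N ≤ k → Dk k f = 0) :
    Hop t a f = ∑ k ∈ Finset.range N, qsym t (a + k) * Dk k f :=
  Psi_eq t a _ N h

theorem Dk_bound (f : Sym F) : ∃ N, ∀ k, N ≤ k → Dk k f = 0 :=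
  ⟨(Dh F f).natDegree + 1, fun _ hk => Polynomial.coeff_eq_zero_of_natDegree_lt (by omega)⟩

theorem Hop_comm [CharZero F] (t : F) (a : ℕ) (f : Sym F) :
    Hop t a (Hop t (a + 1) f) = t • Hop t (a + 1) (Hop t a f) := by
  obtain ⟨N, hN⟩ : ∃ N, (∀ k, N ≤ k → Dk k f = 0) ∧ ∀ k l, N ≤ l → Dk l (Dk k f) = 0 := by
    obtain ⟨N, hN⟩ := Dk_bound f
    choose M hM using fun k => Dk_bound (Dk k f)
    refine ⟨N + ∑ k ∈ Finset.range N, M k, fun k hk => hN k (by omega), fun k l hl => ?_⟩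
    by_cases hk : k < N
    · apply hM
      have := Finset.single_le_sum (f := M) (fun _ _ => Nat.zero_le _) (Finset.mem_range.2 hk)
      omega
    · rw [hN k (by omega)]
      simp [Dk]
  have e1 : Hop t a (Hop t (a + 1) f) = ∑ k ∈ Finset.range N,
      (t • Hop t (a + 1) (qsym t (a + k) * Dk k f) +
      qsym t (a + k + 1) * Hop t a (Dk k f) - qsym t (a + k) * Hop t (a + 1) (Dk k f)) := by
    rw [Hop_eq t (a + 1) f N hN.1, map_sum]
    refine Finset.sum_congr rfl fun k _ => ?_
    rw [← Hop_q]
    congr 3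
    ring
  have e2 : Hop t (a + 1) (Hop t a f) = ∑ k ∈ Finset.range N,
      Hop t (a + 1) (qsym t (a + k) * Dk k f) := by
    rw [Hop_eq t a f N hN.1, map_sum]
  rw [e1, e2, Finset.smul_sum, Finset.sum_sub_distrib, Finset.sum_add_distrib]
  have e3 : ∑ k ∈ Finset.range N, qsym t (a + k + 1) * Hop t a (Dk k f) =
      ∑ k ∈ Finset.range N, qsym t (a + k) * Hop t (a + 1) (Dk k f) := by
    have h1 : ∀ k b, Hop t b (Dk k f) = ∑ l ∈ Finset.range N, qsym t (b + l) * Dk l (Dk k f) :=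
      fun k b => Hop_eq t b _ N (hN.2 k)
    simp only [h1, Finset.mul_sum]
    rw [Finset.sum_comm]
    refine Finset.sum_congr rfl fun k _ => Finset.sum_congr rfl fun l _ => ?_
    rw [Dk_comm f k l]
    have : a + l + 1 = a + 1 + l := by ring
    rw [this]
    ring
  rw [e3]
  abel

theorem Hop_ets_sum [CharZero F] (t : F) (r a : ℕ) : Hop t a (ets F r) =
    ∑ j ∈ Finset.range (r + 1), qsym t (a + j) * ets F (r - j) := by
  induction r generalizing a with
  | zero =>
    rw [ets_zero, Hop_apply, map_one]
    have := Psi_monomial t a 0 1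
    rw [Polynomial.monomial_zero_left, map_one] at this
    rw [this, Finset.sum_range_one, Nat.sub_zero, ets_zero]
  | succ r ih =>
    have := Hop_e t a r 1
    rw [mul_one, mul_one] at this
    have h1 : Hop t a (1 : Sym F) = qsym t a := by
      have := Psi_monomial t a 0 1
      rw [Polynomial.monomial_zero_left, map_one, mul_one] at this
      rw [Hop_apply, map_one]
      exact this
    have h2 : ∑ j ∈ Finset.range (r + 1), qsym t (a + 1 + j) * ets F (r - j) =
        ∑ j ∈ Finset.range (r + 1), qsym t (a + (j + 1)) * ets F (r + 1 - (j + 1)) := by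
      refine Finset.sum_congr rfl fun j _ => ?_
      rw [show a + 1 + j = a + (j + 1) by ring, show r + 1 - (j + 1) = r - j by omega]
    rw [this, ih, Finset.sum_range_succ' _ (r + 1), h1, h2, add_comm, Nat.sub_zero, add_zero,
      mul_comm (qsym t a)]

theorem Hop_zero_ets [CharZero F] (t : F) (r : ℕ) : Hop t 0 (ets F r) = t ^ r • ets F r := by
  have h : PowerSeries.mk (qsym t) * PowerSeries.mk (ets F) =
      PowerSeries.rescale (MvPolynomial.C t) (PowerSeries.mk (ets F)) := by
    apply IsExp.unique ((isExp_qsym t).mul isExp_ets)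
    convert (isExp_ets (F := F)).rescale (MvPolynomial.C t) using 2
    ring
  have := congrArg (PowerSeries.coeff r) h
  rw [PowerSeries.coeff_mul, PowerSeries.coeff_rescale, Finset.Nat.sum_antidiagonal_eq_sum_range_succ
    (f := fun i j => PowerSeries.coeff i (PowerSeries.mk (qsym t)) *
      PowerSeries.coeff j (PowerSeries.mk (ets F)))] at this
  simp only [PowerSeries.coeff_mk] at this
  rw [Hop_ets_sum]
  simp only [zero_add]
  rw [this, MvPolynomial.smul_eq_C_mul, map_pow]

/-- elementary symmetric functions -/
def el (F : Type*) [Field F] (r : ℕ) : Sym F := (-1 : F) ^ r • ets F r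

theorem el_zero [CharZero F] : el F 0 = 1 := by simp [el, ets_zero]

theorem el_Hop [CharZero F] (t : F) (a r : ℕ) (f : Sym F) :
    el F (r + 1) * Hop t a f = Hop t a (el F (r + 1) * f) + Hop t (a + 1) (el F r * f) := by
  have := Hop_e t a r f
  unfold el
  simp only [smul_mul_assoc, map_smul, this, smul_add, pow_succ]
  rw [mul_smul, mul_smul, neg_one_smul, neg_one_smul]
  simp

theorem Hop_one_el [CharZero F] (t : F) (r : ℕ) :
    Hop t 1 (el F r) = (1 - t ^ (r + 1)) • el F (r + 1) := by
  have h := Hop_e t 0 r 1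
  have h1 : Hop t 0 (1 : Sym F) = 1 := by
    have := Hop_zero_ets t 0
    rwa [ets_zero, pow_zero, one_smul] at this
  rw [mul_one, mul_one, Hop_zero_ets, h1, mul_one, zero_add] at h
  unfold el
  rw [map_smul, ← sub_eq_iff_eq_add'.2 h]
  module

/-- adjointness -/
theorem hall_ets [CharZero F] (f g : Sym F) : ∀ r, hall F (ets F r * f) g = hall F f (Dk r g) := by
  induction g using MvPolynomial.induction_on generalizing f with
  | C a =>
    intro r
    have h : ∀ x : Sym F, hall F x (MvPolynomial.C a) = MvPolynomial.coeff 0 x * a := by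
      intro x
      rw [pr_comm, MvPolynomial.C_apply, pr_monomial]
      simp [zd, mul_comm]
    rw [h, Dk_C]
    have : MvPolynomial.coeff 0 (ets F r * f) = MvPolynomial.coeff 0 (ets F r) *
      MvPolynomial.coeff 0 f := by
      simp only [← MvPolynomial.constantCoeff_eq, map_mul]
    rw [this, coeff_ets]
    by_cases hr : r = 0
    · subst hr
      rw [if_pos rfl, h]
      simp [wt, zd]
    · rw [if_neg hr, if_neg]
      · simp
      · simpa [wt] using Ne.symm hr
  | add p q hp hq => intro r; rw [map_add, hp, hq, Dk_add, map_add]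
  | mul_X p n hp =>
    intro r
    have h : ∀ x p : Sym F, hall F x (MvPolynomial.X n * p) =
        ((n : F) + 1) * hall F (MvPolynomial.pderiv n x) p := by
      intro x p
      rw [pr_comm, hall_X_mul, pr_comm]
    rw [mul_comm p, h, Derivation.leibniz, Dk_X_mul, map_sub, h, map_add, LinearMap.add_apply,
      smul_eq_mul, smul_eq_mul, hp, mul_add, mul_comm f, sub_eq_add_neg]
    congr 1
    rw [← smul_eq_mul, ← LinearMap.smul_apply, ← map_smul, ← smul_mul_assoc, pderiv_ets]
    split_ifs with h2
    · rw [neg_mul, map_neg, LinearMap.neg_apply, hp]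
    · simp

end PartD

section PartE

/-- `(t;t)_m` -/
def qp (t : F) (m : ℕ) : F := ∏ j ∈ Finset.range m, (1 - t ^ (j + 1))

theorem qp_zero (t : F) : qp t 0 = 1 := by simp [qp]

theorem qp_succ (t : F) (m : ℕ) : qp t (m + 1) = qp t m * (1 - t ^ (m + 1)) := by
  rw [qp, Finset.prod_range_succ]; rfl

theorem qp_ne_zero {t : F} (ht : ∀ n : ℕ, t ^ (n + 1) ≠ 1) (m : ℕ) : qp t m ≠ 0 := by
  rw [qp, Finset.prod_ne_zero_iff]
  intro j _
  exact sub_ne_zero.2 (ht j).symm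

/-- Gaussian binomials on natural numbers -/
def qb (t : F) (n k : ℕ) : F := if k ≤ n then qp t n / (qp t k * qp t (n - k)) else 0

/-- divided powers of vertex operators -/
def Hd (t : F) (a m : ℕ) : Module.End F (Sym F) := (qp t m)⁻¹ • (Hop t a) ^ m

theorem Hd_zero (t : F) (a : ℕ) (f : Sym F) : Hd t a 0 f = f := by
  simp [Hd, qp_zero]

theorem Hd_succ {t : F} (ht : ∀ n : ℕ, t ^ (n + 1) ≠ 1) (a m : ℕ) (f : Sym F) :
    (1 - t ^ (m + 1)) • Hd t a (m + 1) f = Hop t a (Hd t a m f) := by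
  unfold Hd
  have h1 := qp_ne_zero ht m
  have h2 : 1 - t ^ (m + 1) ≠ 0 := sub_ne_zero.2 (ht m).symm
  rw [LinearMap.smul_apply, LinearMap.smul_apply, map_smul, pow_succ' (Hop t a), qp_succ, smul_smul]
  congr 1
  field_simp

theorem Hd_succ' {t : F} (ht : ∀ n : ℕ, t ^ (n + 1) ≠ 1) (a m : ℕ) (f : Sym F) :
    (1 - t ^ (m + 1)) • Hd t a (m + 1) f = Hd t a m (Hop t a f) := by
  unfold Hd
  have h1 := qp_ne_zero ht m
  have h2 : 1 - t ^ (m + 1) ≠ 0 := sub_ne_zero.2 (ht m).symm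
  rw [LinearMap.smul_apply, LinearMap.smul_apply, pow_succ (Hop t a), qp_succ, smul_smul]
  congr 1
  field_simp

theorem Hd_add {t : F} (ht : ∀ n : ℕ, t ^ (n + 1) ≠ 1) (a k l : ℕ) (f : Sym F) :
    Hd t a k (Hd t a l f) = qb t (k + l) k • Hd t a (k + l) f := by
  unfold Hd qb
  rw [if_pos (by omega), Nat.add_sub_cancel_left]
  simp only [LinearMap.smul_apply, map_smul, pow_add, smul_smul, Module.End.mul_apply]
  congr 1
  have h1 := qp_ne_zero ht k
  have h2 := qp_ne_zero ht l
  have h3 := qp_ne_zero ht (k + l)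
  field_simp

theorem Hd_Hop [CharZero F] {t : F} (a j : ℕ) (f : Sym F) :
    Hd t a j (Hop t (a + 1) f) = t ^ j • Hop t (a + 1) (Hd t a j f) := by
  have h : ((Hop t a) ^ j) (Hop t (a + 1) f) = t ^ j • Hop t (a + 1) (((Hop t a) ^ j) f) := by
    induction j with
    | zero => simp
    | succ j ih =>
      rw [pow_succ', Module.End.mul_apply, ih, map_smul, Hop_comm, smul_smul, ← pow_succ,
        Module.End.mul_apply]
  unfold Hd
  simp only [LinearMap.smul_apply, h, map_smul]
  rw [smul_comm]

/-- shifted elementary functions -/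
def els (F : Type*) [Field F] (r k : ℕ) : Sym F := if k ≤ r then el F (r - k) else 0

theorem els_Hop [CharZero F] (t : F) (a r k : ℕ) (f : Sym F) :
    els F r k * Hop t a f = Hop t a (els F r k * f) + Hop t (a + 1) (els F r (k + 1) * f) := by
  unfold els
  rcases lt_trichotomy k r with h | h | h
  · rw [if_pos h.le, if_pos (by omega)]
    obtain ⟨s, hs⟩ : ∃ s, r - k = s + 1 := ⟨r - k - 1, by omega⟩
    rw [show r - (k + 1) = s by omega, hs, el_Hop]
  · subst h
    simp [el_zero]
  · rw [if_neg (by omega), if_neg (by omega)]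
    simp

theorem el_Hd [CharZero F] {t : F} (ht : ∀ n : ℕ, t ^ (n + 1) ≠ 1) (r a m : ℕ) (f : Sym F) :
    el F r * Hd t a m f =
      ∑ k ∈ Finset.range (m + 1), Hd t (a + 1) k (Hd t a (m - k) (els F r k * f)) := by
  induction m generalizing f with
  | zero => simp [Hd_zero, els]
  | succ m ih =>
    have h2 : 1 - t ^ (m + 1) ≠ 0 := sub_ne_zero.2 (ht m).symm
    apply smul_right_injective _ h2
    dsimp only
    rw [← mul_smul_comm, Hd_succ' ht, ih, Finset.smul_sum]
    have e1 : ∀ k ∈ Finset.range (m + 1),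
        Hd t (a + 1) k (Hd t a (m - k) (els F r k * Hop t a f)) =
        (1 - t ^ (m + 1 - k)) • Hd t (a + 1) k (Hd t a (m + 1 - k) (els F r k * f)) +
        (t ^ (m - k) * (1 - t ^ (k + 1))) •
          Hd t (a + 1) (k + 1) (Hd t a (m + 1 - (k + 1)) (els F r (k + 1) * f)) := by
      intro k hk
      rw [Finset.mem_range] at hk
      rw [els_Hop, map_add, map_add, Hd_Hop, map_smul, ← Hd_succ' ht (a + 1), ← Hd_succ' ht a,
        map_smul, smul_smul, show m - k + 1 = m + 1 - k by omega,
        show m + 1 - (k + 1) = m - k by omega]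
    rw [Finset.sum_congr rfl e1, Finset.sum_add_distrib]
    have e2 : ∀ k ∈ Finset.range (m + 1 + 1), (1 - t ^ (m + 1)) •
          Hd t (a + 1) k (Hd t a (m + 1 - k) (els F r k * f)) =
        (1 - t ^ (m + 1 - k)) • Hd t (a + 1) k (Hd t a (m + 1 - k) (els F r k * f)) +
        (t ^ (m + 1 - k) * (1 - t ^ k)) •
          Hd t (a + 1) k (Hd t a (m + 1 - k) (els F r k * f)) := by
      intro k hk
      rw [Finset.mem_range] at hk
      rw [← add_smul]
      congr 1
      have : t ^ (m + 1) = t ^ (m + 1 - k) * t ^ k := by rw [← pow_add]; congr 1; omega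
      rw [this]
      ring
    rw [Finset.sum_congr rfl e2, Finset.sum_add_distrib]
    congr 1
    · rw [Finset.sum_range_succ _ (m + 1)]
      simp
    · rw [Finset.sum_range_succ' _ (m + 1)]
      simp

theorem el_eq [CharZero F] {t : F} (ht : ∀ n : ℕ, t ^ (n + 1) ≠ 1) (r : ℕ) :
    Hd t 1 r 1 = el F r := by
  induction r with
  | zero => rw [Hd_zero, el_zero]
  | succ r ih =>
    have h2 : 1 - t ^ (r + 1) ≠ 0 := sub_ne_zero.2 (ht r).symm
    apply smul_right_injective _ h2
    dsimp only
    rw [Hd_succ ht, ih, Hop_one_el]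

end PartE

section PartF

/-- partition from a bounded antitone function -/
def mkP (f : ℕ → ℕ) (N : ℕ) (ha : ∀ i j, i ≤ j → f j ≤ f i) (hN : ∀ i, N ≤ i → f i = 0) :
    Partition where
  part := Finsupp.onFinset (Finset.range N) f (by
    intro i hi
    rw [Finset.mem_range]
    by_contra h
    exact hi (hN i (by omega)))
  antitone' := by
    intro i j hij
    exact ha i j hij

theorem mkP_part (f : ℕ → ℕ) (N : ℕ) (ha : ∀ i j, i ≤ j → f j ≤ f i) (hN : ∀ i, N ≤ i → f i = 0)
    (i : ℕ) : (mkP f N ha hN).part i = f i := rfl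

theorem qb_self {t : F} (ht : ∀ n : ℕ, t ^ (n + 1) ≠ 1) (n : ℕ) : qb t n n = 1 := by
  have := qp_ne_zero ht n
  simp [qb, qp_zero, this]

theorem qb_zero {t : F} (ht : ∀ n : ℕ, t ^ (n + 1) ≠ 1) (n : ℕ) : qb t n 0 = 1 := by
  have := qp_ne_zero ht n
  simp [qb, qp_zero, this]

theorem qb_symm (t : F) (k l : ℕ) : qb t (k + l) k = qb t (k + l) l := by
  unfold qb
  rw [if_pos (by omega), if_pos (by omega), Nat.add_sub_cancel_left, Nat.add_sub_cancel, mul_comm]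

/-- iterated vertex operators -/
def Wop (t : F) : ℕ → (ℕ → ℕ) → Sym F
  | 0, _ => 1
  | N + 1, c => Hd t (N + 1) (c N - c (N + 1)) (Wop t N c)

theorem Wop_congr (t : F) (N : ℕ) (c c' : ℕ → ℕ)
    (h : ∀ i, i < N → c i - c (i + 1) = c' i - c' (i + 1)) : Wop t N c = Wop t N c' := by
  induction N with
  | zero => rfl
  | succ N ih =>
    rw [Wop, Wop, h N (by omega), ih (fun i hi => h i (by omega))]

/-- the Hall--Littlewood function with given columns -/
def Rc (t : F) (c : Partition) : Sym F := Wop t c.size c.part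

theorem Rc_eq (t : F) (c : Partition) (N : ℕ) (h : ∀ i, N ≤ i → c.part i = 0) :
    Rc t c = Wop t N c.part := by
  have key : ∀ N M, N ≤ M → (∀ i, N ≤ i → c.part i = 0) → Wop t M c.part = Wop t N c.part := by
    intro N M hNM h
    induction M, hNM using Nat.le_induction with
    | base => rfl
    | succ M hM ih => rw [Wop, h M hM, Nat.zero_sub, Hd_zero, ih]
  have hs : ∀ i, c.size ≤ i → c.part i = 0 := fun i hi => c.part_eq_zero hi
  unfold Rc
  rcases le_total N c.size with h1 | h1
  · exact key N _ h1 h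
  · exact (key _ _ h1 hs).symm

/-- vertical strip condition in columns -/
def VS (d c : Partition) : Prop := ∀ i, c.part i ≤ d.part i ∧ d.part (i + 1) ≤ c.part i

open Classical in
/-- vertical strip coefficients in columns -/
def vsc (t : F) (d c : Partition) : F :=
  if VS d c then ∏ i ∈ Finset.range d.size,
    qb t (d.part i - d.part (i + 1)) (d.part i - c.part i) else 0

theorem prod_range_stable (f : ℕ → F) (N M : ℕ) (hN : ∀ i, N ≤ i → f i = 1)
    (hM : ∀ i, M ≤ i → f i = 1) : ∏ i ∈ Finset.range N, f i = ∏ i ∈ Finset.range M, f i := by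
  have key : ∀ N M, N ≤ M → (∀ i, N ≤ i → f i = 1) →
      ∏ i ∈ Finset.range M, f i = ∏ i ∈ Finset.range N, f i := by
    intro N M hNM h
    induction M, hNM using Nat.le_induction with
    | base => rfl
    | succ M hM ih => rw [Finset.prod_range_succ, h M hM, mul_one, ih]
  rcases le_total N M with h1 | h1
  · exact (key N _ h1 hN).symm
  · exact (key _ _ h1 hM)

theorem vsc_eq {t : F} (ht : ∀ n : ℕ, t ^ (n + 1) ≠ 1) (d c : Partition) (h : VS d c) (N : ℕ)
    (hN : ∀ i, N ≤ i → d.part i = 0) : vsc t d c = ∏ i ∈ Finset.range N,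
    qb t (d.part i - d.part (i + 1)) (d.part i - c.part i) := by
  rw [vsc, if_pos h]
  apply prod_range_stable
  · intro i hi
    rw [d.part_eq_zero hi]
    simp [qb_self ht]
  · intro i hi
    rw [hN i hi]
    simp [qb_self ht]

theorem vsc_VS (t : F) (d c : Partition) (h : vsc t d c ≠ 0) : VS d c := by
  by_contra hc
  exact h (if_neg hc)

/-- subtract a constant -/
def drop (m : ℕ) (d : Partition) : Partition :=
  mkP (fun i => d.part i - m) d.size
    (fun i j hij => Nat.sub_le_sub_right (d.antitone' hij) m)
    (fun i hi => by rw [d.part_eq_zero hi]; simp)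

theorem drop_part (m : ℕ) (d : Partition) (i : ℕ) : (drop m d).part i = d.part i - m := rfl

/-- add a constant to the first entries and append another one -/
def lift (N m k : ℕ) (d : Partition) : Partition :=
  mkP (fun i => if i ≤ N then d.part i + m else if i = N + 1 then min k m else 0) (N + 2)
    (fun i j hij => by
      have := d.antitone' hij
      split_ifs <;> omega)
    (fun i hi => by
      rw [if_neg (by omega), if_neg (by omega)])

theorem lift_part (N m k : ℕ) (d : Partition) (i : ℕ) : (lift N m k d).part i =
    if i ≤ N then d.part i + m else if i = N + 1 then min k m else 0 := rfl

theorem lift_lo (N m k : ℕ) (d : Partition) (i : ℕ) (h : i ≤ N) :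
    (lift N m k d).part i = d.part i + m := by
  rw [lift_part, if_pos h]

theorem lift_mid (N m k : ℕ) (d : Partition) : (lift N m k d).part (N + 1) = min k m := by
  rw [lift_part, if_neg (by omega), if_pos rfl]

theorem lift_hi (N m k : ℕ) (d : Partition) (i : ℕ) (h : N + 2 ≤ i) :
    (lift N m k d).part i = 0 := by
  rw [lift_part, if_neg (by omega), if_neg (by omega)]

theorem size_range (c : Partition) (N : ℕ) (h : ∀ i, N ≤ i → c.part i = 0) :
    c.size = ∑ i ∈ Finset.range N, c.part i := by
  rw [c.size_eq (M := N)]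
  exact h

theorem drop_size (c : Partition) (N : ℕ) (h : ∀ i, N + 1 ≤ i → c.part i = 0) :
    c.size = (drop (c.part N) c).size + (N + 1) * c.part N := by
  rw [size_range c (N + 1) h, size_range (drop (c.part N) c) (N + 1)]
  · have : ∀ i ∈ Finset.range (N + 1), c.part i = (drop (c.part N) c).part i + c.part N := by
      intro i hi
      rw [Finset.mem_range] at hi
      rw [drop_part]
      have := c.antitone' (show i ≤ N by omega)
      omega
    rw [Finset.sum_congr rfl this, Finset.sum_add_distrib]
    simp
  · intro i hi
    rw [drop_part, h i hi]
    simp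

theorem lift_size (N m k : ℕ) (d : Partition) (hk : k ≤ m) (h : ∀ i, N + 1 ≤ i → d.part i = 0) :
    (lift N m k d).size = d.size + (N + 1) * m + k := by
  rw [size_range d (N + 1) h, size_range (lift N m k d) (N + 2), Finset.sum_range_succ _ (N + 1)]
  · have : ∀ i ∈ Finset.range (N + 1), (lift N m k d).part i = d.part i + m := by
      intro i hi
      rw [Finset.mem_range] at hi
      rw [lift_part, if_pos (by omega)]
    rw [Finset.sum_congr rfl this, Finset.sum_add_distrib, lift_part, if_neg (by omega),
      if_pos rfl]
    simp [hk]
  · intro i hi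
    rw [lift_part, if_neg (by omega), if_neg (by omega)]

theorem VS_lift (N k : ℕ) (c d : Partition) (hk : k ≤ c.part N)
    (hc : ∀ i, N + 1 ≤ i → c.part i = 0) (h : VS d (drop (c.part N) c)) :
    VS (lift N (c.part N) k d) c := by
  intro i
  have h1 := h i
  rw [drop_part] at h1
  rcases lt_trichotomy i N with hi | hi | hi
  · have := c.antitone' hi.le
    rw [lift_lo _ _ _ _ _ hi.le, lift_lo _ _ _ _ (i + 1) hi]
    omega
  · subst hi
    rw [lift_lo _ _ _ _ _ le_rfl, lift_mid]
    omega
  · rw [hc i (by omega), lift_hi _ _ _ _ (i + 1) (by omega)]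
    omega

theorem term_lift [CharZero F] {t : F} (ht : ∀ n : ℕ, t ^ (n + 1) ≠ 1) (N k : ℕ) (c d : Partition)
    (hk : k ≤ c.part N) (hc : ∀ i, N + 1 ≤ i → c.part i = 0) (h : VS d (drop (c.part N) c)) :
    vsc t d (drop (c.part N) c) • Hd t (N + 2) k (Hd t (N + 1) (c.part N - k) (Rc t d)) =
      vsc t (lift N (c.part N) k d) c • Rc t (lift N (c.part N) k d) := by
  have hd : ∀ i, N + 1 ≤ i → d.part i = 0 := by
    intro i hi
    obtain ⟨j, rfl⟩ : ∃ j, i = j + 1 := ⟨i - 1, by omega⟩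
    have := (h j).2
    have h2 := c.antitone' (show N ≤ j by omega)
    rw [drop_part] at this
    omega
  have hl := VS_lift N k c d hk hc h
  rw [vsc_eq ht d _ h (N + 1) hd, vsc_eq ht _ c hl (N + 2) (fun i hi => lift_hi _ _ _ _ i hi),
    Rc_eq t d (N + 1) hd, Rc_eq t (lift N (c.part N) k d) (N + 2)
      (fun i hi => lift_hi _ _ _ _ i hi), Wop, Wop, Wop, Hd_add ht]
  have e1 : Wop t N (lift N (c.part N) k d).part = Wop t N d.part := by
    apply Wop_congr
    intro i hi
    rw [lift_lo _ _ _ _ _ hi.le, lift_lo _ _ _ _ (i + 1) hi]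
    omega
  rw [e1, Finset.prod_range_succ, Finset.prod_range_succ _ (N + 1), Finset.prod_range_succ,
    lift_mid, lift_hi _ _ _ _ (N + 1 + 1) (by omega), hc (N + 1) le_rfl, hd (N + 1) le_rfl,
    lift_lo _ _ _ _ N le_rfl, map_smul, smul_smul]
  have e2 : ∀ i ∈ Finset.range N, qb t ((lift N (c.part N) k d).part i -
      (lift N (c.part N) k d).part (i + 1)) ((lift N (c.part N) k d).part i - c.part i) =
      qb t (d.part i - d.part (i + 1)) (d.part i - (drop (c.part N) c).part i) := by
    intro i hi
    rw [Finset.mem_range] at hi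
    have := c.antitone' hi.le
    rw [lift_lo _ _ _ _ _ hi.le, lift_lo _ _ _ _ (i + 1) hi, drop_part]
    congr 1 <;> omega
  rw [Finset.prod_congr rfl e2, drop_part, Nat.sub_self, Nat.sub_zero, Nat.sub_zero, qb_self ht,
    qb_self ht, Nat.min_eq_left hk, Nat.add_sub_cancel, mul_one, mul_one,
    qb_symm, show c.part N - k + d.part N = d.part N + c.part N - k by omega]

theorem VS_drop (N : ℕ) (c d : Partition)
    (h : VS d c) : VS (drop (c.part N) d) (drop (c.part N) c) := by
  intro i
  have h1 := h i
  simp only [drop_part]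
  omega

theorem lift_drop (N : ℕ) (c d : Partition) (hc : ∀ i, N + 1 ≤ i → c.part i = 0)
    (h : VS d c) : lift N (c.part N) (d.part (N + 1)) (drop (c.part N) d) = d := by
  apply Partition.ext'
  intro i
  rw [lift_part, drop_part]
  split_ifs with h1 h2
  · have := c.antitone' h1
    have := (h i).1
    omega
  · have := (h N).2
    subst h2
    omega
  · obtain ⟨j, rfl⟩ : ∃ j, i = j + 1 := ⟨i - 1, by omega⟩
    have := (h j).2
    rw [hc j (by omega)] at this
    omega

theorem Rc_zero [CharZero F] (t : F) (c : Partition) (h : ∀ i, c.part i = 0) : Rc t c = 1 := by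
  rw [Rc_eq t c 0 (fun i _ => h i)]
  rfl

theorem e_pieri [CharZero F] {t : F} (ht : ∀ n : ℕ, t ^ (n + 1) ≠ 1) (N : ℕ) :
    ∀ (c : Partition) (_ : ∀ i, N ≤ i → c.part i = 0) (r : ℕ),
      el F r * Rc t c = ∑ d ∈ pf (c.size + r), vsc t d c • Rc t d := by
  induction N with
  | zero =>
    intro c hc r
    rw [Rc_zero t c (fun i => hc i (by omega)), mul_one]
    have hsz : c.size = 0 := by rw [size_range c 0 hc]; rfl
    let d0 : Partition := mkP (fun i => if i = 0 then r else 0) 1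
      (fun i j hij => by split_ifs <;> omega)
      (fun i hi => by rw [if_neg (by omega)])
    have hd0 : ∀ i, d0.part i = if i = 0 then r else 0 := fun i => rfl
    have hd1 : ∀ i, 1 ≤ i → d0.part i = 0 := fun i hi => by rw [hd0, if_neg (by omega)]
    have hV : VS d0 c := by
      intro i
      rw [hc i (by omega), hd1 (i + 1) (by omega)]
      omega
    rw [Finset.sum_eq_single d0]
    · rw [vsc_eq ht d0 c hV 1 hd1, Rc_eq t d0 1 hd1]
      simp only [Finset.range_one, Finset.prod_singleton, hc 0 le_rfl, hd0, Wop]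
      simp [qb_self ht, el_eq ht]
    · intro d hd hne
      by_cases hv : vsc t d c = 0
      · rw [hv, zero_smul]
      · exfalso
        apply hne
        have hV := vsc_VS _ _ _ hv
        rw [mem_pf] at hd
        have h1 : ∀ i, 1 ≤ i → d.part i = 0 := by
          intro i hi
          obtain ⟨j, rfl⟩ : ∃ j, i = j + 1 := ⟨i - 1, by omega⟩
          have := (hV j).2
          rw [hc j (by omega)] at this
          omega
        have h2 := size_range d 1 h1
        rw [Finset.sum_range_one] at h2
        apply Partition.ext'
        intro i
        rw [hd0]
        split_ifs with h3
        · subst h3; omega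
        · exact h1 i (by omega)
    · intro h
      exfalso
      apply h
      rw [mem_pf, size_range d0 1 hd1, Finset.sum_range_one, hd0, if_pos rfl]
      omega
  | succ N ih =>
    intro c hc r
    set m := c.part N with hm
    have hsz := drop_size c N hc
    rw [← hm] at hsz
    have hcd : ∀ i, N ≤ i → (drop m c).part i = 0 := by
      intro i hi
      rw [drop_part]
      have := c.antitone' hi
      omega
    have e1 : Rc t c = Hd t (N + 1) m (Rc t (drop m c)) := by
      rw [Rc_eq t c (N + 1) hc, Rc_eq t (drop m c) N hcd, Wop, hc (N + 1) le_rfl, Nat.sub_zero]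
      congr 1
      apply Wop_congr
      intro i hi
      have h1 := c.antitone' (show i ≤ N by omega)
      have h2 := c.antitone' (show i + 1 ≤ N by omega)
      rw [drop_part, drop_part]
      omega
    have e2 : ∀ k, els F r k * Rc t (drop m c) =
        ∑ d ∈ pf ((drop m c).size + (r - k)), (if k ≤ r then vsc t d (drop m c) else 0) • Rc t d := by
      intro k
      unfold els
      split_ifs with hk
      · exact ih _ hcd _
      · simp
    rw [e1, el_Hd ht]
    simp only [e2, map_sum, map_smul]
    rw [Finset.sum_sigma']
    refine Finset.sum_bij_ne_zero (fun a _ _ => lift N m a.1 a.2) ?_ ?_ ?_ ?_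
    · rintro ⟨k, d⟩ h1 h2
      dsimp only at h2 ⊢
      rw [Finset.mem_sigma, Finset.mem_range] at h1
      dsimp only at h1
      have h3 := left_ne_zero_of_smul h2
      have hk : k ≤ r := by
        by_contra hk
        rw [if_neg hk] at h3
        exact h3 rfl
      rw [if_pos hk] at h3
      have hV := vsc_VS _ _ _ h3
      have hd : ∀ i, N + 1 ≤ i → d.part i = 0 := by
        intro i hi
        obtain ⟨j, rfl⟩ : ∃ j, i = j + 1 := ⟨i - 1, by omega⟩
        have := (hV j).2
        rw [hcd j (by omega)] at this
        omega
      rw [mem_pf, lift_size N m k d (by omega) hd, mem_pf.1 h1.2]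
      omega
    · rintro ⟨k, d⟩ h1 h2 ⟨k', d'⟩ h1' h2' heq
      dsimp only at h2 h2' heq
      rw [Finset.mem_sigma, Finset.mem_range] at h1 h1'
      dsimp only at h1 h1'
      have h3 := left_ne_zero_of_smul h2
      have h3' := left_ne_zero_of_smul h2'
      have hk : k ≤ r := by
        by_contra hk
        rw [if_neg hk] at h3
        exact h3 rfl
      have hk' : k' ≤ r := by
        by_contra hk
        rw [if_neg hk] at h3'
        exact h3' rfl
      rw [if_pos hk] at h3
      rw [if_pos hk'] at h3'
      have hV := vsc_VS _ _ _ h3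
      have hV' := vsc_VS _ _ _ h3'
      have e : ∀ i, (lift N m k d).part i = (lift N m k' d').part i := fun i => by rw [heq]
      have hkk : k = k' := by
        have := e (N + 1)
        rw [lift_mid, lift_mid] at this
        omega
      subst hkk
      have : d = d' := by
        apply Partition.ext'
        intro i
        by_cases hi : i ≤ N
        · have := e i
          rw [lift_part, lift_part, if_pos hi, if_pos hi] at this
          omega
        · obtain ⟨j, rfl⟩ : ∃ j, i = j + 1 := ⟨i - 1, by omega⟩
          have a1 := (hV j).2
          have a2 := (hV' j).2
          rw [hcd j (by omega)] at a1 a2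
          omega
      rw [this]
    · intro d h1 h2
      have h3 := left_ne_zero_of_smul h2
      have hV := vsc_VS _ _ _ h3
      have hld := lift_drop N c d hc hV
      have hk : d.part (N + 1) ≤ m := (hV N).2
      have hVd := VS_drop N c d hV
      rw [← hm] at hld hVd
      have hd : ∀ i, N + 1 ≤ i → (drop m d).part i = 0 := by
        intro i hi
        obtain ⟨j, rfl⟩ : ∃ j, i = j + 1 := ⟨i - 1, by omega⟩
        have := (hVd j).2
        rw [hcd j (by omega)] at this
        omega
      have hls := lift_size N m (d.part (N + 1)) (drop m d) hk hd
      rw [hld, mem_pf.1 h1] at hls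
      have hsge : (drop m c).size ≤ (drop m d).size := by
        rw [size_range (drop m c) (N + 1) (fun i hi => hcd i (by omega)),
          size_range (drop m d) (N + 1) hd]
        exact Finset.sum_le_sum fun i _ => (hVd i).1
      have hkr : d.part (N + 1) ≤ r := by omega
      have htm := term_lift ht N (d.part (N + 1)) c (drop m d) hk hc hVd
      rw [← hm, hld] at htm
      refine ⟨⟨d.part (N + 1), drop m d⟩, ?_, ?_, hld⟩
      · rw [Finset.mem_sigma, Finset.mem_range, mem_pf]
        dsimp only
        omega
      · dsimp only
        rw [if_pos hkr, htm]
        exact h2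
    · rintro ⟨k, d⟩ h1 h2
      dsimp only at h2 ⊢
      rw [Finset.mem_sigma, Finset.mem_range] at h1
      dsimp only at h1
      have h3 := left_ne_zero_of_smul h2
      have hk : k ≤ r := by
        by_contra hk
        rw [if_neg hk] at h3
        exact h3 rfl
      rw [if_pos hk] at h3 ⊢
      have hV := vsc_VS _ _ _ h3
      exact term_lift ht N k c d (by omega) hc hV

theorem e_pieri' [CharZero F] {t : F} (ht : ∀ n : ℕ, t ^ (n + 1) ≠ 1) (c : Partition) (r : ℕ) :
    el F r * Rc t c = ∑ d ∈ pf (c.size + r), vsc t d c • Rc t d :=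
  e_pieri ht c.size c (fun _ hi => c.part_eq_zero hi) r

end PartF

section PartG

theorem choose_two_succ (y : ℕ) : Nat.choose (y + 1) 2 = Nat.choose y 2 + y := by
  rw [Nat.choose_succ_succ' y 1, Nat.choose_one_right, add_comm]

theorem alt_sum {t : F} (ht : ∀ n : ℕ, t ^ (n + 1) ≠ 1) (n : ℕ) :
    ∑ y ∈ Finset.range (n + 1 + 1),
      (-1 : F) ^ y * t ^ (Nat.choose y 2) * ((qp t y)⁻¹ * (qp t (n + 1 - y))⁻¹) = 0 := by
  have h2 : 1 - t ^ (n + 1) ≠ 0 := sub_ne_zero.2 (ht n).symm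
  apply mul_left_cancel₀ h2
  rw [mul_zero, Finset.mul_sum]
  have e : ∀ y ∈ Finset.range (n + 1 + 1), (1 - t ^ (n + 1)) * ((-1 : F) ^ y * t ^ (Nat.choose y 2) *
      ((qp t y)⁻¹ * (qp t (n + 1 - y))⁻¹)) =
      (-1 : F) ^ y * t ^ (Nat.choose y 2) * ((1 - t ^ y) * (qp t y)⁻¹ * (qp t (n + 1 - y))⁻¹) +
      (-1 : F) ^ y * t ^ (Nat.choose (y + 1) 2) *
        ((qp t y)⁻¹ * ((1 - t ^ (n + 1 - y)) * (qp t (n + 1 - y))⁻¹)) := by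
    intro y hy
    rw [Finset.mem_range] at hy
    have : t ^ (n + 1) = t ^ y * t ^ (n + 1 - y) := by rw [← pow_add]; congr 1; omega
    rw [this, choose_two_succ, pow_add]
    ring
  rw [Finset.sum_congr rfl e, Finset.sum_add_distrib, Finset.sum_range_succ' _ (n + 1),
    Finset.sum_range_succ _ (n + 1)]
  simp only [pow_zero, sub_self, Nat.sub_self, zero_mul, mul_zero, add_zero]
  rw [← Finset.sum_add_distrib]
  apply Finset.sum_eq_zero
  intro y hy
  rw [Finset.mem_range] at hy
  have h3 : n + 1 - y = (n - y) + 1 := by omega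
  have h4 := qp_ne_zero ht y
  have h5 := qp_ne_zero ht (n - y)
  have h6 : 1 - t ^ (y + 1) ≠ 0 := sub_ne_zero.2 (ht y).symm
  have h7 : 1 - t ^ (n - y + 1) ≠ 0 := sub_ne_zero.2 (ht (n - y)).symm
  have h8 : (1 - t ^ (y + 1)) * (qp t (y + 1))⁻¹ = (qp t y)⁻¹ := by
    rw [qp_succ, mul_inv_rev, ← mul_assoc, mul_inv_cancel₀ h6, one_mul]
  have h9 : (1 - t ^ (n - y + 1)) * (qp t (n - y + 1))⁻¹ = (qp t (n - y))⁻¹ := by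
    rw [qp_succ, mul_inv_rev, ← mul_assoc, mul_inv_cancel₀ h7, one_mul]
  rw [h3, h8, h9, show n + 1 - (y + 1) = n - y by omega, pow_succ]
  ring

/-- local factor of the coefficient `sk` -/
def skf (t : F) (d c c' : ℕ) : F := t ^ Nat.choose (d - c) 2 * qb t (d - c') (d - c)

open Classical in
/-- the coefficients `sk` in columns -/
def skc (t : F) (d c : Partition) : F :=
  if ∀ i, c.part i ≤ d.part i then
    ∏ i ∈ Finset.range d.size, skf t (d.part i) (c.part i) (c.part (i + 1)) else 0

theorem skc_eq {t : F} (ht : ∀ n : ℕ, t ^ (n + 1) ≠ 1) (d c : Partition)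
    (h : ∀ i, c.part i ≤ d.part i) (N : ℕ)
    (hN : ∀ i, N ≤ i → d.part i = 0) : skc t d c = ∏ i ∈ Finset.range N,
      skf t (d.part i) (c.part i) (c.part (i + 1)) := by
  rw [skc, if_pos h]
  apply prod_range_stable
  · intro i hi
    rw [d.part_eq_zero hi]
    simp [skf, qb_self ht]
  · intro i hi
    rw [hN i hi]
    simp [skf, qb_self ht]

theorem skc_le (t : F) (d c : Partition) (h : skc t d c ≠ 0) : ∀ i, c.part i ≤ d.part i := by
  by_contra hc
  exact h (if_neg hc)

/-- local factor of the inversion sum -/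
def Gf (t : F) (l l' m m' x : ℕ) : F :=
  (-1) ^ (l - x) * qb t (l - l') (l - x) * (if m ≤ x then skf t x m m' else 0)

theorem Gf_sum_zero {t : F} (ht : ∀ n : ℕ, t ^ (n + 1) ≠ 1) (l m b : ℕ) (h1 : m < l) (h2 : b ≤ m) :
    ∑ x ∈ Finset.Icc b l, Gf t l b m b x = 0 := by
  obtain ⟨n, rfl⟩ : ∃ n, l = m + (n + 1) := ⟨l - m - 1, by omega⟩
  obtain ⟨a, rfl⟩ : ∃ a, m = b + a := ⟨m - b, by omega⟩
  have e1 : ∑ x ∈ Finset.Icc b (b + a + (n + 1)), Gf t (b + a + (n + 1)) b (b + a) b x =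
      ∑ y ∈ Finset.range (n + 1 + 1), Gf t (b + a + (n + 1)) b (b + a) b (b + a + y) := by
    symm
    refine Finset.sum_bij_ne_zero (fun y _ _ => b + a + y) ?_ ?_ ?_ ?_
    · intro y hy _
      rw [Finset.mem_range] at hy
      rw [Finset.mem_Icc]
      omega
    · intro y _ _ y' _ _ h
      omega
    · intro x hx hne
      rw [Finset.mem_Icc] at hx
      have : b + a ≤ x := by
        by_contra hc
        apply hne
        rw [Gf, if_neg hc, mul_zero]
      have hx' : b + a + (x - (b + a)) = x := by omega
      refine ⟨x - (b + a), ?_, ?_, ?_⟩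
      · rw [Finset.mem_range]; omega
      · rw [hx']; exact hne
      · exact hx'
    · intros; rfl
  rw [e1]
  have e2 : ∀ y ∈ Finset.range (n + 1 + 1), Gf t (b + a + (n + 1)) b (b + a) b (b + a + y) =
      (-1) ^ (n + 1) * qp t (n + 1 + a) * (qp t a)⁻¹ * ((-1 : F) ^ y * t ^ (Nat.choose y 2) *
      ((qp t y)⁻¹ * (qp t (n + 1 - y))⁻¹)) := by
    intro y hy
    rw [Finset.mem_range] at hy
    unfold Gf skf qb
    rw [if_pos (by omega), if_pos (by omega), if_pos (by omega),
      show b + a + (n + 1) - (b + a + y) = n + 1 - y by omega,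
      show b + a + (n + 1) - b = n + 1 + a by omega, show b + a + y - (b + a) = y by omega,
      show b + a + y - b = a + y by omega, show n + 1 + a - (n + 1 - y) = a + y by omega,
      show a + y - y = a by omega]
    have h3 := qp_ne_zero ht a
    have h4 := qp_ne_zero ht y
    have h5 := qp_ne_zero ht (n + 1 - y)
    have h6 := qp_ne_zero ht (a + y)
    have h7 : (-1 : F) ^ (n + 1 - y) = (-1) ^ (n + 1) * (-1) ^ y := by
      have : (-1 : F) ^ (n + 1) = (-1) ^ (n + 1 - y) * (-1) ^ y := by
        rw [← pow_add]; congr 1; omega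
      rw [this, mul_assoc, ← pow_add, ← two_mul, pow_mul]
      simp
    rw [h7]
    field_simp
  rw [Finset.sum_congr rfl e2, ← Finset.mul_sum, alt_sum ht, mul_zero]

open Classical in
theorem Gf_prod {t : F} (ht : ∀ n : ℕ, t ^ (n + 1) ≠ 1) (l m : Partition) (N : ℕ)
    (hl : ∀ i, N ≤ i → l.part i = 0) (hm : ∀ i, N ≤ i → m.part i = 0) :
    ∏ i : Fin N, ∑ x ∈ Finset.Icc (l.part (i + 1)) (l.part i),
      Gf t (l.part i) (l.part (i + 1)) (m.part i) (m.part (i + 1)) x =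
    if l = m then 1 else 0 := by
  split_ifs with h
  · subst h
    apply Finset.prod_eq_one
    intro i _
    rw [Finset.sum_eq_single (l.part i)]
    · unfold Gf skf
      simp [qb_zero ht]
    · intro x hx hne
      rw [Finset.mem_Icc] at hx
      rw [Gf, if_neg (by omega), mul_zero]
    · intro hx
      exfalso
      apply hx
      rw [Finset.mem_Icc]
      exact ⟨l.antitone' (by omega), le_rfl⟩
  · by_cases hle : ∀ i, m.part i ≤ l.part i
    · have hex : ∃ i, i < N ∧ m.part i < l.part i := by
        by_contra hc
        push Not at hc
        apply h
        apply Partition.ext'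
        intro i
        by_cases hi : i < N
        · exact le_antisymm (hc i hi) (hle i)
        · rw [hl i (by omega), hm i (by omega)]
      obtain ⟨i, hi, hmax⟩ := Finset.exists_max_image
        ((Finset.range N).filter (fun i => m.part i < l.part i)) id
        (by obtain ⟨i, h1, h2⟩ := hex; exact ⟨i, by simp [h1, h2]⟩)
      rw [Finset.mem_filter, Finset.mem_range] at hi
      have he : l.part (i + 1) = m.part (i + 1) := by
        by_cases hi1 : i + 1 < N
        · by_contra hc
          have := hmax (i + 1) (by
            rw [Finset.mem_filter, Finset.mem_range]
            have := hle (i + 1)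
            omega)
          simp at this
        · rw [hl _ (by omega), hm _ (by omega)]
      apply Finset.prod_eq_zero (Finset.mem_univ (⟨i, hi.1⟩ : Fin N))
      dsimp only
      rw [he]
      exact Gf_sum_zero ht _ _ _ hi.2 (m.antitone' (by omega))
    · push Not at hle
      obtain ⟨i, hi⟩ := hle
      have hiN : i < N := by
        by_contra hc
        rw [hm i (by omega)] at hi
        omega
      apply Finset.prod_eq_zero (Finset.mem_univ (⟨i, hiN⟩ : Fin N))
      apply Finset.sum_eq_zero
      intro x hx
      rw [Finset.mem_Icc] at hx
      dsimp only at hx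
      rw [Gf, if_neg, mul_zero]
      dsimp only
      omega

theorem term_G {t : F} (ht : ∀ n : ℕ, t ^ (n + 1) ≠ 1) (l m v : Partition) (N : ℕ)
    (hl : ∀ i, N ≤ i → l.part i = 0) (hm : ∀ i, N ≤ i → m.part i = 0) (hV : VS l v) (k : ℕ) (hk : l.size = v.size + k) :
    (-1) ^ k * vsc t l v * skc t v m = ∏ i : Fin N,
      Gf t (l.part i) (l.part (i + 1)) (m.part i) (m.part (i + 1)) (v.part i) := by
  have hv : ∀ i, N ≤ i → v.part i = 0 := by
    intro i hi
    have := (hV i).1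
    rw [hl i hi] at this
    omega
  rw [Fin.prod_univ_eq_prod_range
    (fun i => Gf t (l.part i) (l.part (i + 1)) (m.part i) (m.part (i + 1)) (v.part i))]
  by_cases hle : ∀ i, m.part i ≤ v.part i
  · rw [vsc_eq ht l v hV N hl, skc_eq ht v m hle N hv]
    unfold Gf
    have e : k = ∑ i ∈ Finset.range N, (l.part i - v.part i) := by
      rw [Finset.sum_tsub_distrib, ← size_range l N hl, ← size_range v N hv]
      · omega
      · exact fun i _ => (hV i).1
    rw [e, ← Finset.prod_pow_eq_pow_sum, ← Finset.prod_mul_distrib, ← Finset.prod_mul_distrib]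
    refine Finset.prod_congr rfl fun i _ => ?_
    rw [if_pos (hle i)]
  · have : skc t v m = 0 := if_neg hle
    rw [this, mul_zero]
    push Not at hle
    obtain ⟨i, hi⟩ := hle
    symm
    by_cases hiN : i < N
    · apply Finset.prod_eq_zero (Finset.mem_range.2 hiN)
      rw [Gf, if_neg (by omega), mul_zero]
    · rw [hm i (by omega)] at hi
      omega

open Classical in
theorem inversion {t : F} (ht : ∀ n : ℕ, t ^ (n + 1) ≠ 1) (l m : Partition) (r : ℕ)
    (hr : l.size = m.size + r) :
    ∑ k ∈ Finset.range (r + 1), ∑ v ∈ pf (m.size + (r - k)),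
      (-1) ^ k * vsc t l v * skc t v m = if l = m then 1 else 0 := by
  set N := l.size + m.size with hN
  have hl : ∀ i, N ≤ i → l.part i = 0 := fun i hi => l.part_eq_zero (by omega)
  have hm : ∀ i, N ≤ i → m.part i = 0 := fun i hi => m.part_eq_zero (by omega)
  rw [← Gf_prod ht l m N hl hm, Finset.prod_univ_sum, Finset.sum_sigma']
  have facts : ∀ a : (_ : ℕ) × Partition, a ∈ (Finset.range (r + 1)).sigma
      (fun k => pf (m.size + (r - k))) → (-1) ^ a.1 * vsc t l a.2 * skc t a.2 m ≠ 0 →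
      VS l a.2 ∧ l.size = a.2.size + a.1 := by
    rintro ⟨k, v⟩ h1 h2
    rw [Finset.mem_sigma, Finset.mem_range, mem_pf] at h1
    dsimp only at h1 h2
    exact ⟨vsc_VS t l v (right_ne_zero_of_mul (left_ne_zero_of_mul h2)), by dsimp only; omega⟩
  refine Finset.sum_bij_ne_zero (fun a _ _ => fun i : Fin N => a.2.part i) ?_ ?_ ?_ ?_
  · intro a h1 h2
    obtain ⟨hV, _⟩ := facts a h1 h2
    rw [Fintype.mem_piFinset]
    intro i
    rw [Finset.mem_Icc]
    exact ⟨(hV i).2, (hV i).1⟩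
  · rintro ⟨k, v⟩ h1 h2 ⟨k', v'⟩ h1' h2' he
    obtain ⟨hV, hs⟩ := facts _ h1 h2
    obtain ⟨hV', hs'⟩ := facts _ h1' h2'
    dsimp only at hV hs hV' hs' he
    have : v = v' := by
      apply Partition.ext'
      intro i
      by_cases hi : i < N
      · exact congrFun he ⟨i, hi⟩
      · have a1 := (hV i).1
        have a2 := (hV' i).1
        rw [hl i (by omega)] at a1 a2
        omega
    subst this
    have : k = k' := by omega
    rw [this]
  · intro g h1 h2
    rw [Fintype.mem_piFinset] at h1
    have h1' : ∀ i (hi : i < N), l.part (i + 1) ≤ g ⟨i, hi⟩ ∧ g ⟨i, hi⟩ ≤ l.part i := by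
      intro i hi
      have := h1 ⟨i, hi⟩
      rwa [Finset.mem_Icc] at this
    let v : Partition := mkP (fun i => if hi : i < N then g ⟨i, hi⟩ else 0) N
      (by
        intro i j hij
        rcases hij.eq_or_lt with rfl | hlt
        · exact le_rfl
        · split_ifs with a1 a2
          · have := (h1' i a2).1
            have := (h1' j a1).2
            have := l.antitone' (show i + 1 ≤ j by omega)
            omega
          · omega
          · omega
          · omega)
      (by
        intro i hi
        rw [dif_neg (by omega)])
    have hv : ∀ i (hi : i < N), v.part i = g ⟨i, hi⟩ := by
      intro i hi
      exact dif_pos hi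
    have hv' : ∀ i, N ≤ i → v.part i = 0 := by
      intro i hi
      exact dif_neg (by omega)
    have hV : VS l v := by
      intro i
      by_cases hi : i < N
      · rw [hv i hi]
        exact ⟨(h1' i hi).2, (h1' i hi).1⟩
      · rw [hv' i (by omega), hl i (by omega), hl (i + 1) (by omega)]
        omega
    have hsz : v.size ≤ l.size := by
      rw [size_range v N hv', size_range l N hl]
      exact Finset.sum_le_sum fun i _ => (hV i).1
    have hgv : (fun i : Fin N => v.part i) = g := by
      funext i
      exact hv i i.2
    have htm := term_G ht l m v N hl hm hV (l.size - v.size) (by omega)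
    have hne : (-1) ^ (l.size - v.size) * vsc t l v * skc t v m ≠ 0 := by
      rw [htm]
      convert h2 using 4
      exact congrFun hgv _
    have hle := skc_le t v m (right_ne_zero_of_mul hne)
    have hsz2 : m.size ≤ v.size := by
      rw [size_range v N hv', size_range m N hm]
      exact Finset.sum_le_sum fun i _ => hle i
    refine ⟨⟨l.size - v.size, v⟩, ?_, hne, hgv⟩
    rw [Finset.mem_sigma, Finset.mem_range, mem_pf]
    dsimp only
    omega
  · intro a h1 h2
    obtain ⟨hV, hs⟩ := facts a h1 h2
    exact term_G ht l m a.2 N hl hm hV a.1 hs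

theorem ets_h [CharZero F] (r : ℕ) : ∑ k ∈ Finset.range (r + 1), ets F k * hsym F (r - k) =
    if r = 0 then 1 else 0 := by
  have h : PowerSeries.mk (ets F) * hser F = 1 := by
    apply IsExp.unique _ IsExp.zero
    convert (isExp_ets (F := F)).mul isExp_hser using 2
    ring
  have := congrArg (PowerSeries.coeff r) h
  rw [PowerSeries.coeff_mul, PowerSeries.coeff_one, Finset.Nat.sum_antidiagonal_eq_sum_range_succ
    (f := fun i j => PowerSeries.coeff i (PowerSeries.mk (ets F)) *
      PowerSeries.coeff j (hser F))] at this
  simpa [hser] using this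

theorem ets_el (r : ℕ) : ets F r = (-1 : F) ^ r • el F r := by
  rw [el, smul_smul, ← mul_pow]
  simp

theorem ets_A [CharZero F] {t : F} (ht : ∀ n : ℕ, t ^ (n + 1) ≠ 1) (m : Partition) (r : ℕ) :
    ∑ k ∈ Finset.range (r + 1), ets F k * (∑ v ∈ pf (m.size + (r - k)), skc t v m • Rc t v) =
    if r = 0 then Rc t m else 0 := by
  classical
  have e1 : ∀ k ∈ Finset.range (r + 1),
      ets F k * (∑ v ∈ pf (m.size + (r - k)), skc t v m • Rc t v) =
      ∑ l ∈ pf (m.size + r), (∑ v ∈ pf (m.size + (r - k)),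
        (-1) ^ k * vsc t l v * skc t v m) • Rc t l := by
    intro k hk
    rw [Finset.mem_range] at hk
    simp only [Finset.sum_smul]
    rw [Finset.sum_comm, Finset.mul_sum]
    refine Finset.sum_congr rfl fun v hv => ?_
    rw [mem_pf] at hv
    rw [mul_smul_comm, ets_el, smul_mul_assoc, e_pieri' ht, hv,
      show m.size + (r - k) + k = m.size + r by omega, Finset.smul_sum, Finset.smul_sum]
    refine Finset.sum_congr rfl fun l _ => ?_
    rw [smul_smul, smul_smul]
    congr 1
    ring
  rw [Finset.sum_congr rfl e1, Finset.sum_comm]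
  have e2 : ∀ l ∈ pf (m.size + r), ∑ k ∈ Finset.range (r + 1), (∑ v ∈ pf (m.size + (r - k)),
        (-1) ^ k * vsc t l v * skc t v m) • Rc t l = if l = m then Rc t l else 0 := by
    intro l hl
    rw [mem_pf] at hl
    rw [← Finset.sum_smul, inversion ht l m r hl]
    split_ifs <;> simp
  rw [Finset.sum_congr rfl e2, Finset.sum_ite_eq' (pf (m.size + r)) m]
  simp [mem_pf]

theorem h_pieri [CharZero F] {t : F} (ht : ∀ n : ℕ, t ^ (n + 1) ≠ 1) (m : Partition) (r : ℕ) :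
    hsym F r * Rc t m = ∑ v ∈ pf (m.size + r), skc t v m • Rc t v := by
  induction r using Nat.strong_induction_on with
  | _ r ih =>
    have h1 := ets_A ht m r
    have h2 : ∑ k ∈ Finset.range (r + 1), ets F k * (hsym F (r - k) * Rc t m) =
        if r = 0 then Rc t m else 0 := by
      have := congrArg (· * Rc t m) (ets_h (F := F) r)
      rw [Finset.sum_mul] at this
      simp only [mul_assoc] at this
      rw [this]
      split_ifs <;> simp
    rw [← h1, Finset.sum_range_succ', Finset.sum_range_succ' _ r] at h2
    have h3 : ∑ k ∈ Finset.range r, ets F (k + 1) * (hsym F (r - (k + 1)) * Rc t m) =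
        ∑ k ∈ Finset.range r, ets F (k + 1) *
          (∑ v ∈ pf (m.size + (r - (k + 1))), skc t v m • Rc t v) := by
      refine Finset.sum_congr rfl fun k hk => ?_
      rw [Finset.mem_range] at hk
      rw [ih (r - (k + 1)) (by omega)]
    rw [h3, ets_zero, one_mul, one_mul, Nat.sub_zero] at h2
    exact add_left_cancel h2

end PartG

section PartH

/-- prefix sums of a list -/
def ts (l : List ℕ) (k : ℕ) : ℕ := (l.take k).sum

theorem ts_zero (l : List ℕ) : ts l 0 = 0 := by simp [ts]

theorem ts_nil (k : ℕ) : ts [] k = 0 := by simp [ts]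

theorem ts_cons (b : ℕ) (l : List ℕ) (k : ℕ) : ts (b :: l) (k + 1) = b + ts l k := by simp [ts]

theorem ts_sum (l : List ℕ) (k : ℕ) (h : l.length ≤ k) : ts l k = l.sum := by
  rw [ts, List.take_of_length_le h]

/-- product of a family over a list -/
def gp (g : ℕ → Sym F) (l : List ℕ) : Sym F := (l.map g).prod

theorem gp_nil (g : ℕ → Sym F) : gp g [] = 1 := by simp [gp]

theorem gp_cons (g : ℕ → Sym F) (b : ℕ) (l : List ℕ) : gp g (b :: l) = g b * gp g l := by simp [gp]

/-- span of products -/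
def spn (g : ℕ → Sym F) (p : List ℕ → Prop) : Submodule F (Sym F) :=
  Submodule.span F (Set.image (gp g) {l | p l})

theorem spn_mem (g : ℕ → Sym F) (p : List ℕ → Prop) (l : List ℕ) (h : p l) : gp g l ∈ spn g p :=
  Submodule.subset_span ⟨l, h, rfl⟩

theorem spn_map (g : ℕ → Sym F) (p : List ℕ → Prop) (φ : Sym F →ₗ[F] Sym F)
    (S : Submodule F (Sym F)) (h : ∀ l, p l → φ (gp g l) ∈ S) (x : Sym F) (hx : x ∈ spn g p) :
    φ x ∈ S := by
  unfold spn at hx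
  induction hx using Submodule.span_induction with
  | mem x hx =>
    obtain ⟨l, hl, rfl⟩ := hx
    exact h l hl
  | zero => rw [map_zero]; exact S.zero_mem
  | add x y _ _ hx hy => rw [map_add]; exact S.add_mem hx hy
  | smul a x _ hx => rw [map_smul]; exact S.smul_mem a hx

theorem spn_mono (g : ℕ → Sym F) (p q : List ℕ → Prop) (h : ∀ l, p l → q l) (x : Sym F)
    (hx : x ∈ spn g p) : x ∈ spn g q :=
  spn_map g p LinearMap.id _ (fun l hl => spn_mem g q l (h l hl)) x hx

theorem spn_cons (g : ℕ → Sym F) (p q : List ℕ → Prop) (b : ℕ) (h : ∀ l, p l → q (b :: l))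
    (x : Sym F) (hx : x ∈ spn g p) : g b * x ∈ spn g q :=
  spn_map g p (LinearMap.mulLeft F (g b)) _ (fun l hl => by
    rw [LinearMap.mulLeft_apply, ← gp_cons]
    exact spn_mem g q _ (h l hl)) x hx

theorem spn_zero (g : ℕ → Sym F) (p : List ℕ → Prop) (φ : Sym F →ₗ[F] F)
    (h : ∀ l, p l → φ (gp g l) = 0) (x : Sym F) (hx : x ∈ spn g p) : φ x = 0 := by
  unfold spn at hx
  induction hx using Submodule.span_induction with
  | mem x hx =>
    obtain ⟨l, hl, rfl⟩ := hx
    exact h l hl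
  | zero => rw [map_zero]
  | add x y _ _ hx hy => rw [map_add, hx, hy, add_zero]
  | smul a x _ hx => rw [map_smul, hx, smul_zero]

theorem Dk_mul (k : ℕ) (f g : Sym F) : Dk k (f * g) =
    ∑ x ∈ Finset.HasAntidiagonal.antidiagonal k, Dk x.1 f * Dk x.2 g := by
  unfold Dk
  rw [map_mul, Polynomial.coeff_mul]

theorem Dk_one (k : ℕ) : Dk k (1 : Sym F) = if k = 0 then 1 else 0 := by
  have := Dk_C (F := F) k 1
  simpa using this

theorem Dk_h_zero [CharZero F] (b : ℕ) (f : Sym F) :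
    Dk 0 (hsym F b * f) = hsym F b * Dk 0 f := by
  cases b with
  | zero => rw [hsym_zero, one_mul, one_mul]
  | succ b =>
    unfold Dk
    rw [map_mul, Dh_h, sub_mul, Polynomial.coeff_sub, Polynomial.coeff_C_mul, mul_assoc,
      Polynomial.coeff_X_mul_zero, sub_zero]

theorem Dk_h_succ [CharZero F] (b k : ℕ) (f : Sym F) :
    Dk (k + 1) (hsym F (b + 1) * f) = hsym F (b + 1) * Dk (k + 1) f - hsym F b * Dk k f := by
  unfold Dk
  rw [map_mul, Dh_h, sub_mul, Polynomial.coeff_sub, Polynomial.coeff_C_mul, mul_assoc,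
      Polynomial.coeff_X_mul, Polynomial.coeff_C_mul]

theorem Dk_zero_gp [CharZero F] (l : List ℕ) : Dk 0 (gp (hsym F) l) = gp (hsym F) l := by
  induction l with
  | nil => rw [gp_nil, Dk_one, if_pos rfl]
  | cons b l ih => rw [gp_cons, Dk_h_zero, ih]

/-- the triangularity of lowering operators on products of complete functions -/
theorem Dk_gp_h [CharZero F] (l : List ℕ) : ∀ r, Dk r (gp (hsym F) l) ∈ spn (hsym F)
    (fun l' => l'.sum + r = l.sum ∧ ∀ k, ts l k ≤ ts l' k + min k r) := by
  induction l with
  | nil =>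
    intro r
    rw [gp_nil, Dk_one]
    split_ifs with h
    · rw [← gp_nil (hsym F)]
      apply spn_mem
      simp [h]
    · exact Submodule.zero_mem _
  | cons b l ih =>
    intro r
    rw [gp_cons]
    cases r with
    | zero =>
      rw [Dk_h_zero]
      refine spn_cons _ _ _ _ ?_ _ (ih 0)
      rintro l' ⟨h1, h2⟩
      refine ⟨by simpa using h1, fun k => ?_⟩
      cases k with
      | zero => simp [ts_zero]
      | succ k =>
        have := h2 k
        rw [ts_cons, ts_cons]
        omega
    | succ r =>
      have key : hsym F b * Dk (r + 1) (gp (hsym F) l) ∈ spn (hsym F)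
          (fun l' => l'.sum + (r + 1) = (b :: l).sum ∧ ∀ k, ts (b :: l) k ≤ ts l' k + min k (r + 1)) := by
        refine spn_cons _ _ _ _ ?_ _ (ih (r + 1))
        rintro l' ⟨h1, h2⟩
        refine ⟨by simp only [List.sum_cons]; omega, fun k => ?_⟩
        cases k with
        | zero => simp [ts_zero]
        | succ k =>
          have := h2 k
          rw [ts_cons, ts_cons]
          omega
      cases b with
      | zero => rwa [hsym_zero, one_mul] at key ⊢
      | succ b =>
        rw [Dk_h_succ]
        refine Submodule.sub_mem _ key ?_
        refine spn_cons _ _ _ _ ?_ _ (ih r)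
        rintro l' ⟨h1, h2⟩
        refine ⟨by simp only [List.sum_cons]; omega, fun k => ?_⟩
        cases k with
        | zero => simp [ts_zero]
        | succ k =>
          have := h2 k
          rw [ts_cons, ts_cons]
          omega

/-- decrement the first entries -/
def dec : ℕ → List ℕ → List ℕ
  | 0, l => l
  | _ + 1, [] => []
  | r + 1, b :: l => (b - 1) :: dec r l

theorem Dk_gp_diag [CharZero F] (r : ℕ) : ∀ l : List ℕ, (∀ k, k < r → ts l k < ts l (k + 1)) →
    Dk r (gp (hsym F) l) - (-1 : F) ^ r • gp (hsym F) (dec r l) ∈ spn (hsym F)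
    (fun l' => ∃ k, ts l k < ts l' k + min k r) ∧ ∀ k, ts (dec r l) k + min k r = ts l k := by
  induction r with
  | zero =>
    intro l _
    rw [Dk_zero_gp, dec, pow_zero, one_smul, sub_self]
    exact ⟨Submodule.zero_mem _, fun k => by simp⟩
  | succ r ih =>
    intro l hl
    cases l with
    | nil =>
      have := hl 0 (by omega)
      rw [ts_nil, ts_nil] at this
      omega
    | cons b l =>
      have h0 := hl 0 (by omega)
      rw [ts_zero, ts_cons, ts_zero] at h0
      obtain ⟨b, rfl⟩ : ∃ b', b = b' + 1 := ⟨b - 1, by omega⟩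
      obtain ⟨ih1, ih2⟩ := ih l (fun k hk => by
        have := hl (k + 1) (by omega)
        rw [ts_cons, ts_cons] at this
        omega)
      constructor
      · rw [gp_cons, Dk_h_succ, dec, Nat.add_sub_cancel, gp_cons]
        have e : hsym F (b + 1) * Dk (r + 1) (gp (hsym F) l) - hsym F b * Dk r (gp (hsym F) l) -
            (-1 : F) ^ (r + 1) • (hsym F b * gp (hsym F) (dec r l)) =
            hsym F (b + 1) * Dk (r + 1) (gp (hsym F) l) -
            hsym F b * (Dk r (gp (hsym F) l) - (-1 : F) ^ r • gp (hsym F) (dec r l)) := by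
          rw [mul_sub, mul_smul_comm, pow_succ]
          module
        rw [e]
        refine Submodule.sub_mem _ ?_ ?_
        · refine spn_cons _ _ _ _ ?_ _ (Dk_gp_h l (r + 1))
          rintro l' -
          refine ⟨1, ?_⟩
          rw [ts_cons, ts_cons, ts_zero, ts_zero]
          omega
        · refine spn_cons _ _ _ _ ?_ _ ih1
          rintro l' ⟨k, hk⟩
          refine ⟨k + 1, ?_⟩
          rw [ts_cons, ts_cons]
          omega
      · intro k
        cases k with
        | zero => simp [ts_zero]
        | succ k =>
          have := ih2 k
          rw [dec, ts_cons, ts_cons]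
          omega

/-- triangularity -/
def Tri (f : Sym F) (n : ℕ) (p : ℕ → ℕ) : Prop :=
  ∀ l : List ℕ, hall F f (gp (hsym F) l) ≠ 0 → l.sum = n ∧ ∀ k, ts l k ≤ p k

/-- normalization -/
def Dia (f : Sym F) (p : ℕ → ℕ) : Prop :=
  ∀ l : List ℕ, (∀ k, ts l k = p k) → hall F f (gp (hsym F) l) = 1

theorem hall_el [CharZero F] (f g : Sym F) (r : ℕ) :
    hall F (el F r * f) g = (-1 : F) ^ r * hall F f (Dk r g) := by
  rw [el, smul_mul_assoc, map_smul, LinearMap.smul_apply, hall_ets, smul_eq_mul]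

theorem Tri_el [CharZero F] (f : Sym F) (n r : ℕ) (p : ℕ → ℕ) (h : Tri f n p) :
    Tri (el F r * f) (n + r) (fun k => p k + min k r) := by
  intro l hl
  by_contra hc
  apply hl
  rw [hall_el]
  rw [spn_zero (hsym F) _ (hall F f) ?_ _ (Dk_gp_h l r), mul_zero]
  rintro l' ⟨h1, h2⟩
  by_contra hne
  obtain ⟨h3, h4⟩ := h l' hne
  apply hc
  refine ⟨by omega, fun k => ?_⟩
  have := h2 k
  have := h4 k
  dsimp only
  omega

theorem Dia_el [CharZero F] (f : Sym F) (n r : ℕ) (p : ℕ → ℕ) (hp : Monotone p) (h : Tri f n p)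
    (h' : Dia f p) : Dia (el F r * f) (fun k => p k + min k r) := by
  intro l hl
  dsimp only at hl
  obtain ⟨h1, h2⟩ := Dk_gp_diag (F := F) r l (fun k hk => by
    have := hp (show k ≤ k + 1 by omega)
    rw [hl, hl]
    omega)
  have h3 := spn_zero (hsym F) _ (hall F f) (fun l' hl' => by
    by_contra hne
    obtain ⟨k, hk⟩ := hl'
    have h4 := (h l' hne).2 k
    rw [hl] at hk
    omega) _ h1
  rw [map_sub, map_smul, h' (dec r l) (fun k => by
    have a := h2 k
    rw [hl] at a
    omega), sub_eq_zero] at h3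
  rw [hall_el, h3, smul_eq_mul, mul_one, ← pow_add, ← two_mul, pow_mul]
  simp

end PartH

section PartI

theorem psc_zero (c : Partition) : psc c 0 = 0 := by
  rw [psc_eq c 0 (fun i hi => c.part_eq_zero hi)]
  simp

theorem psc_mono (c : Partition) : Monotone (psc c) := by
  intro k k' h
  rw [psc_eq c k (fun i hi => c.part_eq_zero hi), psc_eq c k' (fun i hi => c.part_eq_zero hi)]
  exact Finset.sum_le_sum fun i _ => by omega

theorem psc_ge (c : Partition) (k : ℕ) (h : c.size ≤ k) : psc c k = c.size := by
  rw [psc_eq c k (fun i hi => c.part_eq_zero hi)]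
  conv_rhs => rw [size_range c c.size (fun i hi => c.part_eq_zero hi)]
  refine Finset.sum_congr rfl fun i _ => ?_
  have := c.part_le i
  omega

theorem psum_inj (c d : Partition) (h : ∀ k, c.psum k = d.psum k) : c = d := by
  apply Partition.ext'
  intro i
  have h1 := h i
  have h2 := h (i + 1)
  unfold Partition.psum at h1 h2
  rw [Finset.sum_range_succ, Finset.sum_range_succ] at h2
  omega

theorem psc_inj (c d : Partition) (h : ∀ k, psc c k = psc d k) : c = d := by
  rw [← c.T_T, ← d.T_T]
  congr 1
  apply psum_inj
  intro k
  rw [Partition.psum_eq, Partition.psum_eq, c.T_T, d.T_T, h]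

/-- measure of the dominance order -/
def dmes (c : Partition) : ℕ := ∑ k ∈ Finset.range (c.size + 1), psc c k

theorem dmes_lt (c d : Partition) (hs : d.size = c.size) (h : ∀ k, psc d k ≤ psc c k)
    (hne : d ≠ c) : dmes d < dmes c := by
  unfold dmes
  rw [hs]
  refine Finset.sum_lt_sum (fun k _ => h k) ?_
  by_contra hc
  push Not at hc
  apply hne
  apply psc_inj
  intro k
  by_cases hk : k < c.size + 1
  · exact le_antisymm (h k) (hc k (Finset.mem_range.2 hk))
  · rw [psc_ge d k (by omega), psc_ge c k (by omega), hs]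

theorem psc_VS (d c : Partition) (r : ℕ) (h : VS d c) (hs : d.size = c.size + r) (k : ℕ) :
    psc d k ≤ psc c k + min k r := by
  have b1 : ∀ i, d.size ≤ i → d.part i = 0 := fun i hi => d.part_eq_zero hi
  have b1' : ∀ i, d.size + 1 ≤ i → d.part i = 0 := fun i hi => d.part_eq_zero (by omega)
  have b2 : ∀ i, d.size ≤ i → c.part i = 0 := fun i hi => c.part_eq_zero (by omega)
  have h1 : psc d k ≤ psc c k + k := by
    rw [psc_eq d k b1', psc_eq c k b2, Finset.sum_range_succ']
    refine Nat.add_le_add (Finset.sum_le_sum fun i _ => ?_) (by omega)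
    have := (h i).2
    omega
  have h2 : psc d k + c.size ≤ psc c k + d.size := by
    obtain ⟨M, e1, e2, b1, b2⟩ : ∃ M, c.size = ∑ i ∈ Finset.range M, c.part i ∧
        d.size = ∑ i ∈ Finset.range M, d.part i ∧ (∀ i, M ≤ i → d.part i = 0) ∧
        (∀ i, M ≤ i → c.part i = 0) :=
      ⟨d.size, size_range c d.size b2, size_range d d.size b1, b1, b2⟩
    rw [psc_eq d k b1, psc_eq c k b2, e1, e2, ← Finset.sum_add_distrib, ← Finset.sum_add_distrib]
    refine Finset.sum_le_sum fun i _ => ?_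
    have := (h i).1
    omega
  omega

theorem constCoeff_gp [CharZero F] (l : List ℕ) :
    MvPolynomial.coeff 0 (gp (hsym F) l) ≠ 0 → l.sum = 0 := by
  induction l with
  | nil => intro _; rfl
  | cons b l ih =>
    intro h
    rw [gp_cons, ← MvPolynomial.constantCoeff_eq, map_mul] at h
    have h1 := left_ne_zero_of_mul h
    have h2 := ih (right_ne_zero_of_mul h)
    rw [MvPolynomial.constantCoeff_eq, coeff_hsym] at h1
    have : b = 0 := by
      by_contra hb
      apply h1
      rw [if_neg]
      simp [wt]
      omega
    simp [this, h2]

theorem hall_one [CharZero F] (g : Sym F) : hall F 1 g = MvPolynomial.coeff 0 g := by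
  have := pr_monomial (zd F) 0 1 g
  rw [show (MvPolynomial.monomial (0 : ℕ →₀ ℕ)) (1 : F) = 1 from rfl] at this
  rw [hall, this]
  simp [zd]

theorem exists_last (c : Partition) (h : c.size ≠ 0) : ∃ N, c.part N ≠ 0 ∧
    ∀ i, N + 1 ≤ i → c.part i = 0 := by
  classical
  have hb := c.exists_bound
  have h1 := Nat.find_spec hb
  have h2 := fun m => Nat.find_min hb (m := m)
  generalize Nat.find hb = M at h1 h2
  cases M with
  | zero =>
    exfalso
    apply h
    rw [size_range c 0 h1]
    rfl
  | succ M =>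
    refine ⟨M, fun h3 => h2 M (by omega) fun i hi => ?_, h1⟩
    have := c.antitone' hi
    omega

/-- truncation -/
def trunc (N : ℕ) (c : Partition) : Partition :=
  mkP (fun i => if i < N then c.part i else 0) N
    (fun i j hij => by
      have := c.antitone' hij
      split_ifs <;> omega)
    (fun i hi => by rw [if_neg (by omega)])

theorem trunc_part (N : ℕ) (c : Partition) (i : ℕ) :
    (trunc N c).part i = if i < N then c.part i else 0 := rfl

theorem trunc_sum (N : ℕ) (c : Partition) (hc : ∀ i, N + 1 ≤ i → c.part i = 0) :
    c.size = (trunc N c).size + c.part N ∧ ∀ k, psc c k = psc (trunc N c) k + min k (c.part N) := by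
  have hb : ∀ i, N ≤ i → (trunc N c).part i = 0 := fun i hi => by
    rw [trunc_part, if_neg (by omega)]
  constructor
  · rw [size_range c (N + 1) hc, size_range _ N hb, Finset.sum_range_succ]
    congr 1
    refine Finset.sum_congr rfl fun i hi => ?_
    rw [trunc_part, if_pos (Finset.mem_range.1 hi)]
  · intro k
    rw [psc_eq c k hc, psc_eq _ k hb, Finset.sum_range_succ, min_comm k]
    congr 1
    refine Finset.sum_congr rfl fun i hi => ?_
    rw [trunc_part, if_pos (Finset.mem_range.1 hi)]

theorem trunc_VS (N : ℕ) (c : Partition) (hc : ∀ i, N + 1 ≤ i → c.part i = 0) :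
    VS c (trunc N c) := by
  intro i
  rw [trunc_part]
  have := c.antitone' (show i ≤ i + 1 by omega)
  split_ifs with h
  · omega
  · rw [hc (i + 1) (by omega)]
    omega

theorem trunc_vsc {t : F} (ht : ∀ n : ℕ, t ^ (n + 1) ≠ 1) (N : ℕ) (c : Partition)
    (hc : ∀ i, N + 1 ≤ i → c.part i = 0) : vsc t c (trunc N c) = 1 := by
  rw [vsc_eq ht c _ (trunc_VS N c hc) (N + 1) hc]
  refine Finset.prod_eq_one fun i hi => ?_
  rw [trunc_part]
  split_ifs with h
  · rw [Nat.sub_self, qb_zero ht]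
  · rw [Finset.mem_range] at hi
    rw [hc (i + 1) (by omega), Nat.sub_zero, qb_self ht]

theorem Rc_tri [CharZero F] {t : F} (ht : ∀ n : ℕ, t ^ (n + 1) ≠ 1) (n : ℕ) : ∀ (m : ℕ)
    (c : Partition), c.size = n → dmes c = m → Tri (Rc t c) c.size (psc c) ∧
      Dia (Rc t c) (psc c) := by
  induction n using Nat.strong_induction_on with
  | _ n ihn =>
  intro m
  induction m using Nat.strong_induction_on with
  | _ m ihm =>
  intro c hn hm
  by_cases h0 : c.size = 0
  · have hz : ∀ i, c.part i = 0 := fun i => c.part_eq_zero (by omega)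
    have hp : ∀ k, psc c k = 0 := fun k => by rw [psc_ge c k (by omega), h0]
    rw [Rc_zero t c hz]
    constructor
    · intro l hl
      rw [hall_one] at hl
      have hs := constCoeff_gp l hl
      refine ⟨by omega, fun k => ?_⟩
      have : ts l k ≤ l.sum := (List.take_sublist k l).sum_le_sum (by simp)
      omega
    · intro l hl
      have hs : l.sum = 0 := by
        rw [← ts_sum l l.length le_rfl, hl, hp]
      have : gp (hsym F) l = 1 := by
        unfold gp
        apply List.prod_eq_one
        intro x hx
        rw [List.mem_map] at hx
        obtain ⟨b, hb, rfl⟩ := hx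
        rw [List.sum_eq_zero_iff] at hs
        rw [hs b hb, hsym_zero]
      rw [this, hall_one]
      simp
  · obtain ⟨N, hN, hc⟩ := exists_last c h0
    obtain ⟨hs, hp⟩ := trunc_sum N c hc
    obtain ⟨i1, i2⟩ := ihn (trunc N c).size (by omega) _ (trunc N c) rfl rfl
    have j1 := Tri_el _ _ (c.part N) _ i1
    have j2 := Dia_el _ _ (c.part N) _ (psc_mono _) i1 i2
    have hpf : (fun k => psc (trunc N c) k + min k (c.part N)) = psc c := by
      funext k
      rw [hp]
    rw [hpf, ← hs] at j1
    rw [hpf] at j2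
    rw [e_pieri' ht, ← hs] at j1 j2
    classical
    rw [← Finset.add_sum_erase _ _ (mem_pf.2 (rfl : c.size = c.size)), trunc_vsc ht N c hc,
      one_smul] at j1 j2
    have key : ∀ d ∈ (pf c.size).erase c, vsc t d (trunc N c) ≠ 0 →
        (Tri (Rc t d) c.size (psc c) ∧ ∃ k, psc d k < psc c k ∧ Tri (Rc t d) c.size (psc d)) := by
      intro d hd hv
      rw [Finset.mem_erase, mem_pf] at hd
      have hle : ∀ k, psc d k ≤ psc c k := fun k => by
        rw [hp]
        exact psc_VS d _ _ (vsc_VS _ _ _ hv) (by omega) k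
      have hlt := dmes_lt c d hd.2 hle hd.1
      obtain ⟨k1, k2⟩ := ihm (dmes d) (by omega) d (by omega) rfl
      rw [hd.2] at k1
      refine ⟨fun l hl => ?_, ?_⟩
      · obtain ⟨a, b⟩ := k1 l hl
        exact ⟨a, fun k => (b k).trans (hle k)⟩
      · by_contra hcon
        push Not at hcon
        exact hd.1 (psc_inj _ _ fun k => le_antisymm (hle k) (by
          by_contra hk
          exact hcon k (by omega) k1))
    constructor
    · intro l hl
      by_contra hcon
      have z1 : hall F (∑ d ∈ (pf c.size).erase c, vsc t d (trunc N c) • Rc t d) (gp (hsym F) l) = 0 := by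
        rw [map_sum, LinearMap.sum_apply]
        refine Finset.sum_eq_zero fun d hd => ?_
        rw [map_smul, LinearMap.smul_apply]
        by_cases hv : vsc t d (trunc N c) = 0
        · rw [hv, zero_smul]
        · have := (key d hd hv).1 l
          rw [not_imp_comm.1 this hcon, smul_zero]
      have z2 := not_imp_comm.1 (j1 l) hcon
      rw [map_add, LinearMap.add_apply, z1, add_zero] at z2
      exact hl z2
    · intro l hl
      have z1 : hall F (∑ d ∈ (pf c.size).erase c, vsc t d (trunc N c) • Rc t d) (gp (hsym F) l) = 0 := by
        rw [map_sum, LinearMap.sum_apply]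
        refine Finset.sum_eq_zero fun d hd => ?_
        rw [map_smul, LinearMap.smul_apply]
        by_cases hv : vsc t d (trunc N c) = 0
        · rw [hv, zero_smul]
        · obtain ⟨-, k, h1, h2⟩ := key d hd hv
          have : hall F (Rc t d) (gp (hsym F) l) = 0 := by
            by_contra hne
            have := (h2 l hne).2 k
            rw [hl] at this
            omega
          rw [this, smul_zero]
      have z2 := j2 l hl
      rwa [map_add, LinearMap.add_apply, z1, add_zero] at z2

end PartI

section PartJ

theorem Dk_q [CharZero F] (t : F) (b : ℕ) : ∀ i, ∃ a : F, Dk i (qsym t b) = a • qsym t (b - i) ∧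
    (b < i → a = 0) := by
  induction b with
  | zero =>
    intro i
    rw [qsym_zero, Dk_one]
    by_cases h : i = 0
    · exact ⟨1, by simp [h, qsym_zero], by omega⟩
    · exact ⟨0, by simp [h], fun _ => rfl⟩
  | succ b ih =>
    have h := Dh_q t b
    rw [sub_eq_iff_eq_add, mul_assoc] at h
    intro i
    cases i with
    | zero =>
      refine ⟨1, ?_, by omega⟩
      unfold Dk
      rw [h]
      simp
    | succ i =>
      obtain ⟨a, h1, h2⟩ := ih i
      have e : Dk (i + 1) (qsym t (b + 1)) = t • Dk i (qsym t b) -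
          (if i = 0 then qsym t b else 0) := by
        unfold Dk
        rw [h, Polynomial.coeff_add, Polynomial.coeff_C_mul, Polynomial.coeff_X_mul,
          Polynomial.coeff_sub, Polynomial.coeff_X_mul, Polynomial.coeff_C_succ,
          Polynomial.coeff_C, MvPolynomial.smul_eq_C_mul]
        ring
      rw [e, h1]
      by_cases hi : i = 0
      · subst hi
        refine ⟨t * a - 1, ?_, by omega⟩
        simp only [if_true, Nat.sub_zero, Nat.add_sub_cancel]
        module
      · refine ⟨t * a, ?_, fun hb => by rw [h2 (by omega), mul_zero]⟩
        rw [if_neg hi, sub_zero, smul_smul, Nat.add_sub_add_right]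

theorem Dk_gp_q [CharZero F] (t : F) (l : List ℕ) : ∀ k, Dk k (gp (qsym t) l) ∈ spn (qsym t)
    (fun l' => l'.sum + k = l.sum ∧ ∀ j, ts l j ≤ ts l' j + k) := by
  induction l with
  | nil =>
    intro r
    rw [gp_nil, Dk_one]
    split_ifs with h
    · rw [← gp_nil (qsym t)]
      apply spn_mem
      simp [h]
    · exact Submodule.zero_mem _
  | cons b l ih =>
    intro k
    rw [gp_cons, Dk_mul]
    refine Submodule.sum_mem _ ?_
    rintro ⟨i, j⟩ hij
    rw [Finset.HasAntidiagonal.mem_antidiagonal] at hij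
    dsimp only at hij ⊢
    obtain ⟨a, h1, h2⟩ := Dk_q t b i
    by_cases hb : b < i
    · rw [h1, h2 hb, zero_smul, zero_mul]
      exact Submodule.zero_mem _
    rw [h1, smul_mul_assoc]
    refine Submodule.smul_mem _ _ ?_
    refine spn_cons _ _ _ _ ?_ _ (ih j)
    rintro l' ⟨h3, h4⟩
    refine ⟨by simp only [List.sum_cons]; omega, fun k => ?_⟩
    cases k with
    | zero => simp [ts_zero]
    | succ k =>
      have := h4 k
      rw [ts_cons, ts_cons]
      omega

theorem Hop_gp_q [CharZero F] (t : F) (a : ℕ) (l : List ℕ) : Hop t a (gp (qsym t) l) ∈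
    spn (qsym t) (fun l' => l'.sum = a + l.sum ∧ ∀ j, ts (a :: l) j ≤ ts l' j) := by
  obtain ⟨N, hN⟩ := Dk_bound (gp (qsym t) l)
  rw [Hop_eq t a _ N hN]
  refine Submodule.sum_mem _ fun k _ => ?_
  refine spn_cons _ _ _ _ ?_ _ (Dk_gp_q t l k)
  rintro l' ⟨h3, h4⟩
  refine ⟨by simp only [List.sum_cons]; omega, fun k => ?_⟩
  cases k with
  | zero => simp [ts_zero]
  | succ k =>
    have := h4 k
    rw [ts_cons, ts_cons]
    omega

/-- iterated operators -/
def Hlist (t : F) (l : List ℕ) : Sym F := l.foldr (fun a f => Hop t a f) 1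

theorem Hlist_mem [CharZero F] (t : F) (l : List ℕ) : Hlist t l ∈
    spn (qsym t) (fun l' => l'.sum = l.sum ∧ ∀ j, ts l j ≤ ts l' j) := by
  induction l with
  | nil =>
    rw [Hlist, List.foldr_nil, ← gp_nil (qsym t)]
    exact spn_mem _ _ _ ⟨rfl, fun _ => le_rfl⟩
  | cons a l ih =>
    rw [Hlist, List.foldr_cons]
    refine spn_map (qsym t) _ (Hop t a) _ ?_ _ ih
    rintro l' ⟨h1, h2⟩
    refine spn_mono _ _ _ ?_ _ (Hop_gp_q t a l')
    rintro l'' ⟨h3, h4⟩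
    refine ⟨by simp only [List.sum_cons]; omega, fun k => ?_⟩
    cases k with
    | zero => simp [ts_zero]
    | succ k =>
      have a1 := h4 (k + 1)
      have a2 := h2 k
      rw [ts_cons] at a1 ⊢
      omega

/-- rows from columns -/
def al : ℕ → (ℕ → ℕ) → List ℕ
  | 0, _ => []
  | N + 1, c => List.replicate (c N - c (N + 1)) (N + 1) ++ al N c

theorem Hlist_replicate (t : F) (a m : ℕ) (l : List ℕ) :
    Hlist t (List.replicate m a ++ l) = (Hop t a ^ m) (Hlist t l) := by
  induction m with
  | zero => simp
  | succ m ih =>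
    rw [List.replicate_succ, List.cons_append, Hlist, List.foldr_cons, ← Hlist, ih, pow_succ']
    rfl

theorem Wop_al (t : F) (N : ℕ) (c : ℕ → ℕ) : ∃ a : F, Wop t N c = a • Hlist t (al N c) := by
  induction N with
  | zero => exact ⟨1, by simp [Wop, al, Hlist]⟩
  | succ N ih =>
    obtain ⟨a, ha⟩ := ih
    refine ⟨(qp t (c N - c (N + 1)))⁻¹ * a, ?_⟩
    rw [Wop, ha, al, Hlist_replicate, Hd, LinearMap.smul_apply, map_smul, smul_smul]

theorem ts_replicate (m a : ℕ) (l : List ℕ) : ∀ k,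
    ts (List.replicate m a ++ l) k = min k m * a + ts l (k - m) := by
  induction m with
  | zero => intro k; simp
  | succ m ih =>
    intro k
    cases k with
    | zero => simp [ts_zero]
    | succ k =>
      rw [List.replicate_succ, List.cons_append, ts_cons, ih, Nat.add_sub_add_right,
        Nat.add_min_add_right, Nat.add_mul]
      omega

theorem ts_al (N : ℕ) (c : ℕ → ℕ) (hc : ∀ i j, i ≤ j → c j ≤ c i) : ∀ k,
    ts (al N c) k = ∑ i ∈ Finset.range N, min (c i - c N) k := by
  induction N with
  | zero => intro k; simp [al, ts_nil]
  | succ N ih =>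
    intro k
    rw [al, ts_replicate, ih, Finset.sum_range_succ]
    have e : ∀ i ∈ Finset.range N, min (c i - c (N + 1)) k = min k (c N - c (N + 1)) +
        min (c i - c N) (k - (c N - c (N + 1))) := by
      intro i hi
      have h1 := hc i N (Finset.mem_range.1 hi).le
      have h2 := hc N (N + 1) (by omega)
      omega
    rw [Finset.sum_congr rfl e, Finset.sum_add_distrib, Finset.sum_const, Finset.card_range,
      smul_eq_mul, min_comm (c N - c (N + 1)) k]
    ring

theorem al_psc (c : Partition) (k : ℕ) : ts (al c.size c.part) k = psc c k := by
  rw [ts_al _ _ (fun i j h => c.antitone' h), psc_eq c k (fun i hi => c.part_eq_zero hi),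
    c.part_eq_zero le_rfl]
  rfl

/-- membership of Rc in a span of products of q -/
theorem Rc_mem [CharZero F] (t : F) (c : Partition) : Rc t c ∈ spn (qsym t)
    (fun l => l.sum = c.size ∧ ∀ k, psc c k ≤ ts l k) := by
  obtain ⟨a, ha⟩ := Wop_al t c.size c.part
  have hts := al_psc c
  have hsum : (al c.size c.part).sum = c.size := by
    rw [← ts_sum _ ((al c.size c.part).length + c.size) (by omega), hts, psc_ge _ _ (by omega)]
  unfold Rc
  rw [ha]
  refine Submodule.smul_mem _ _ ?_
  refine spn_mono _ _ _ ?_ _ (Hlist_mem t _)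
  rintro l ⟨h1, h2⟩
  exact ⟨by omega, fun k => by rw [← hts]; exact h2 k⟩

theorem hl_gp (t : F) (ht : ∀ n : ℕ, t ^ (n + 1) ≠ 1) (f : Sym F) (l : List ℕ) :
    hl t f (gp (qsym t) l) = hall F f (gp (hsym F) l) := by
  rw [← hl_scal t ht]
  congr 1
  unfold gp
  rw [map_list_prod, List.map_map]
  rfl

theorem hl_Rc [CharZero F] {t : F} (ht : ∀ n : ℕ, t ^ (n + 1) ≠ 1) (f : Sym F) (n : ℕ)
    (p : ℕ → ℕ) (hf : Tri f n p) (c : Partition) (h : hl t f (Rc t c) ≠ 0) :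
    c.size = n ∧ ∀ k, psc c k ≤ p k := by
  by_contra hcon
  apply h
  refine spn_zero _ _ (hl t f) ?_ _ (Rc_mem t c)
  rintro l ⟨h1, h2⟩
  by_contra hne
  rw [hl_gp t ht] at hne
  obtain ⟨h3, h4⟩ := hf l hne
  exact hcon ⟨by omega, fun k => (h2 k).trans (h4 k)⟩

theorem Rc_orth [CharZero F] {t : F} (ht : ∀ n : ℕ, t ^ (n + 1) ≠ 1) (c d : Partition)
    (h : hl t (Rc t c) (Rc t d) ≠ 0) : c = d := by
  have h1 := hl_Rc ht _ _ _ (Rc_tri ht _ _ c rfl rfl).1 d h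
  rw [hl, pr_comm] at h
  have h2 := hl_Rc ht _ _ _ (Rc_tri ht _ _ d rfl rfl).1 c h
  exact psc_inj _ _ fun k => le_antisymm (h2.2 k) (h1.2 k)

/-- the span of all Rc -/
def RS (t : F) : Submodule F (Sym F) := Submodule.span F (Set.range (Rc t))

theorem RS_h [CharZero F] {t : F} (ht : ∀ n : ℕ, t ^ (n + 1) ≠ 1) (r : ℕ) (x : Sym F)
    (hx : x ∈ RS t) : hsym F r * x ∈ RS t := by
  unfold RS at hx
  induction hx using Submodule.span_induction with
  | mem x hx =>
    obtain ⟨c, rfl⟩ := hx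
    rw [h_pieri ht]
    exact Submodule.sum_mem _ fun d _ => Submodule.smul_mem _ _ (Submodule.subset_span ⟨d, rfl⟩)
  | zero => rw [mul_zero]; exact Submodule.zero_mem _
  | add x y _ _ hx hy => rw [mul_add]; exact Submodule.add_mem _ hx hy
  | smul a x _ hx => rw [mul_smul_comm]; exact Submodule.smul_mem _ _ hx

theorem adjoin_h [CharZero F] : Algebra.adjoin F (Set.range (hsym F)) = ⊤ := by
  rw [eq_top_iff, ← MvPolynomial.adjoin_range_X]
  refine Algebra.adjoin_le ?_
  rintro _ ⟨n, rfl⟩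
  have hh : ∀ r, hsym F r ∈ Algebra.adjoin F (Set.range (hsym F)) := fun r =>
    Algebra.subset_adjoin ⟨r, rfl⟩
  induction n using Nat.strong_induction_on with
  | _ n ih =>
    have h := (isExp_hser (F := F)).2 n
    rw [Finset.Nat.sum_antidiagonal_eq_sum_range_succ_mk, Finset.sum_range_succ] at h
    simp only [hser, PowerSeries.coeff_mk, Nat.sub_self, hsym_zero, mul_one] at h
    have h2 := eq_sub_of_add_eq' h.symm
    rw [h2]
    refine Subalgebra.sub_mem _ (Subalgebra.mul_mem _ ?_ (hh _)) (Subalgebra.sum_mem _ ?_)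
    · exact_mod_cast Subalgebra.natCast_mem _ (n + 1)
    · intro i hi
      exact Subalgebra.mul_mem _ (ih i (Finset.mem_range.1 hi)) (hh _)

theorem RS_top [CharZero F] {t : F} (ht : ∀ n : ℕ, t ^ (n + 1) ≠ 1) (x : Sym F) : x ∈ RS t := by
  have h1 : (1 : Sym F) ∈ RS t := by
    let z : Partition := mkP (fun _ => 0) 0 (fun _ _ _ => le_rfl) (fun _ _ => rfl)
    rw [← Rc_zero t z (fun i => rfl)]
    exact Submodule.subset_span ⟨z, rfl⟩
  have key : ∀ y ∈ Algebra.adjoin F (Set.range (hsym F)), ∀ x ∈ RS t, y * x ∈ RS t := by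
    intro y hy
    induction hy using Algebra.adjoin_induction with
    | mem y hy =>
      obtain ⟨r, rfl⟩ := hy
      exact RS_h ht r
    | algebraMap a =>
      intro x hx
      rw [← Algebra.smul_def]
      exact Submodule.smul_mem _ _ hx
    | add y z _ _ hy hz =>
      intro x hx
      rw [add_mul]
      exact Submodule.add_mem _ (hy x hx) (hz x hx)
    | mul y z _ _ hy hz =>
      intro x hx
      rw [mul_assoc]
      exact hy _ (hz x hx)
  have := key x (by rw [adjoin_h]; trivial) 1 h1
  rwa [mul_one] at this

theorem Rc_perp [CharZero F] {t : F} (ht : ∀ n : ℕ, t ^ (n + 1) ≠ 1) (f : Sym F)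
    (h : ∀ c, hl t f (Rc t c) = 0) : f = 0 := by
  apply pr_nondeg (wq t) (wq_ne_zero t ht)
  intro g
  have hg := RS_top ht g
  unfold RS at hg
  induction hg using Submodule.span_induction with
  | mem x hx =>
    obtain ⟨c, rfl⟩ := hx
    exact h c
  | zero => rw [map_zero]
  | add x y _ _ hx hy => rw [map_add, hx, hy, add_zero]
  | smul a x _ hx => rw [map_smul, hx, smul_zero]

theorem Rc_ne_zero [CharZero F] {t : F} (ht : ∀ n : ℕ, t ^ (n + 1) ≠ 1) (c : Partition) :
    Rc t c ≠ 0 := by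
  intro h
  have := (Rc_tri ht _ _ c rfl rfl).2 _ (al_psc c)
  rw [h, map_zero, LinearMap.zero_apply] at this
  exact zero_ne_one this

theorem Rc_norm [CharZero F] {t : F} (ht : ∀ n : ℕ, t ^ (n + 1) ≠ 1) (c : Partition) :
    hl t (Rc t c) (Rc t c) ≠ 0 := by
  intro h
  apply Rc_ne_zero ht c
  apply Rc_perp ht
  intro d
  by_contra hd
  have := Rc_orth ht c d hd
  subst this
  exact hd h

end PartJ

section PartK

theorem ts_getD (l : List ℕ) : ∀ k, ts l k = ∑ i ∈ Finset.range k, l.getD i 0 := by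
  induction l with
  | nil => intro k; simp [ts_nil]
  | cons b l ih =>
    intro k
    cases k with
    | zero => simp [ts_zero]
    | succ k =>
      rw [ts_cons, Finset.sum_range_succ', ih]
      simp [add_comm]

theorem gp_getD (g : ℕ → Sym F) (l : List ℕ) :
    gp g l = ∏ i ∈ Finset.range l.length, g (l.getD i 0) := by
  induction l with
  | nil => simp [gp_nil]
  | cons b l ih =>
    rw [gp_cons, List.length_cons, Finset.prod_range_succ', ih]
    simp [mul_comm]

theorem list_part [CharZero F] (l : List ℕ) (a : Partition) (h : ∀ i, l.getD i 0 = a.part i) :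
    gp (hsym F) l = hprod F a ∧ (∀ k, ts l k = a.psum k) ∧ l.sum = a.size := by
  have hb : ∀ i, l.length ≤ i → a.part i = 0 := fun i hi => by
    rw [← h, List.getD_eq_default _ _ hi]
  refine ⟨?_, fun k => ?_, ?_⟩
  · rw [gp_getD, hprod, Finset.prod_congr rfl (fun i _ => by rw [h])]
    symm
    refine Finset.prod_subset ?_ ?_
    · intro i hi
      rw [Finset.mem_range]
      by_contra hc
      exact (Finsupp.mem_support_iff.1 hi) (hb i (by omega))
    · intro i _ hi
      rw [Finsupp.notMem_support_iff.1 hi, hsym_zero]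
  · rw [ts_getD]
    exact Finset.sum_congr rfl fun i _ => h i
  · rw [← ts_sum l l.length le_rfl, ts_getD, size_range a l.length hb]
    exact Finset.sum_congr rfl fun i _ => h i

theorem ts_ins (a : ℕ) (l : List ℕ) : ∀ k, a + ts l k ≤ ts (l.orderedInsert (· ≥ ·) a) (k + 1) := by
  induction l with
  | nil => intro k; simp [ts_cons]
  | cons b l ih =>
    intro k
    rw [List.orderedInsert]
    split_ifs with h
    · rw [ts_cons]
    · rw [ts_cons]
      cases k with
      | zero =>
        rw [ts_zero, ts_zero]
        omega
      | succ k =>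
        have := ih k
        rw [ts_cons]
        omega

theorem ts_sort (l : List ℕ) : ∀ k, ts l k ≤ ts (l.insertionSort (· ≥ ·)) k := by
  induction l with
  | nil => intro k; simp
  | cons b l ih =>
    intro k
    cases k with
    | zero => simp [ts_zero]
    | succ k =>
      rw [List.insertionSort_cons, ts_cons]
      have := ts_ins b (l.insertionSort (· ≥ ·)) k
      have := ih k
      omega

theorem gp_perm (g : ℕ → Sym F) (l l' : List ℕ) (h : l.Perm l') : gp g l = gp g l' :=
  (h.map g).prod_eq

theorem sorted_part (l : List ℕ) (h : l.Pairwise (· ≥ ·)) :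
    ∃ a : Partition, ∀ i, l.getD i 0 = a.part i := by
  refine ⟨mkP (fun i => l.getD i 0) l.length ?_ ?_, fun i => rfl⟩
  · intro i j hij
    by_cases hj : j < l.length
    · rw [List.getD_eq_getElem _ _ hj, List.getD_eq_getElem _ _ (by omega : i < l.length)]
      rcases eq_or_lt_of_le hij with e | e
      · subst e
        exact le_rfl
      · exact List.pairwise_iff_getElem.1 h i j (by omega) hj e
    · rw [List.getD_eq_default _ _ (by omega : l.length ≤ j)]
      omega
  · intro i hi
    exact List.getD_eq_default _ _ hi

theorem P_tri [CharZero F] {t : F} (ht : ∀ n : ℕ, t ^ (n + 1) ≠ 1) (P : Partition → Sym F)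
    (hP : IsMacdonald 0 t P) (a : Partition) : Tri (P a) a.size (psc a.T) := by
  intro l hl
  obtain ⟨b, hb⟩ := sorted_part (l.insertionSort (· ≥ ·)) (List.pairwise_insertionSort _ l)
  obtain ⟨h1, h2, h3⟩ := list_part (F := F) _ b hb
  have hperm := List.perm_insertionSort (· ≥ ·) l
  rw [gp_perm _ _ _ hperm] at h1
  rw [hperm.sum_eq] at h3
  rw [h1, ← innerQT_tt t ht] at hl
  have hd := not_imp_comm.1 (hP.2.2 a b) hl
  refine ⟨h3.trans hd.1, fun k => ?_⟩
  rw [← Partition.psum_eq]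
  exact (ts_sort l k).trans ((h2 k).le.trans (hd.2 k))

theorem P_eq [CharZero F] {t : F} (ht : ∀ n : ℕ, t ^ (n + 1) ≠ 1) (P : Partition → Sym F)
    (hP : IsMacdonald 0 t P) (m : ℕ) : ∀ c : Partition, dmes c = m → P c.T = Rc t c := by
  induction m using Nat.strong_induction_on with
  | _ m ih =>
    intro c hm
    have hor : ∀ d, d ≠ c → hl t (P c.T) (Rc t d) = 0 := by
      intro d hd
      by_contra hne
      obtain ⟨h1, h2⟩ := hl_Rc ht _ _ _ (P_tri ht P hP c.T) d hne
      rw [c.T_T] at h2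
      rw [c.size_T] at h1
      have hlt := dmes_lt c d h1 h2 hd
      rw [← ih (dmes d) (by omega) d rfl, ← innerQT_zero] at hne
      apply hne
      apply hP.1
      intro h
      apply hd
      rw [← d.T_T, ← c.T_T, h]
    have hn := Rc_norm ht c
    set x : F := hl t (P c.T) (Rc t c) / hl t (Rc t c) (Rc t c) with hx
    have h1 : P c.T - x • Rc t c = 0 := by
      apply Rc_perp ht
      intro d
      rw [map_sub, LinearMap.sub_apply, map_smul, LinearMap.smul_apply]
      by_cases hd : d = c
      · subst hd
        rw [smul_eq_mul, hx, div_mul_cancel₀ _ hn, sub_self]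
      · have : hl t (Rc t c) (Rc t d) = 0 := by
          by_contra hne
          exact hd (Rc_orth ht c d hne).symm
        rw [hor d hd, this, smul_zero, sub_zero]
    rw [sub_eq_zero] at h1
    have h2 := hP.2.1 c.T
    rw [innerQT_tt t ht] at h2
    obtain ⟨g1, g2, -⟩ := list_part (F := F) ((List.range c.T.size).map c.T.part) c.T (by
      intro i
      by_cases hi : i < c.T.size
      · rw [List.getD_eq_getElem _ _ (by simpa using hi)]
        simp
      · rw [List.getD_eq_default _ _ (by simpa using hi), c.T.part_eq_zero (by omega)])
    have h3 := (Rc_tri ht _ _ c rfl rfl).2 _ (fun k => by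
      rw [g2 k, Partition.psum_eq, c.T_T])
    rw [g1] at h3
    rw [h1, map_smul, LinearMap.smul_apply, h3, smul_eq_mul, mul_one] at h2
    rw [h1, h2, one_smul]

theorem P_eq' [CharZero F] {t : F} (ht : ∀ n : ℕ, t ^ (n + 1) ≠ 1) (P : Partition → Sym F)
    (hP : IsMacdonald 0 t P) (a : Partition) : P a = Rc t a.T := by
  have := P_eq ht P hP _ a.T rfl
  rwa [a.T_T] at this

end PartK

section PartL

theorem qfac_eq {t : F} (n : ℕ) : qfac t n * (1 - t) ^ n = qp t n := by
  induction n with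
  | zero => simp [qfac, qp_zero]
  | succ n ih =>
    have h := geom_sum_mul t (n + 1)
    rw [qp_succ, ← ih, qfac, Finset.prod_range_succ, ← qfac, qint, pow_succ]
    linear_combination (-(qfac t n * (1 - t) ^ n)) * h

theorem qbinom_eq {t : F} (ht : ∀ n : ℕ, t ^ (n + 1) ≠ 1) (n k : ℕ) :
    qbinom t (n : ℤ) (k : ℤ) = qb t n k := by
  have h1 : (1 - t) ≠ 0 := by
    have := ht 0
    rw [zero_add, pow_one] at this
    exact sub_ne_zero.2 this.symm
  unfold qbinom qb
  by_cases h : k ≤ n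
  · rw [if_pos ⟨by omega, by omega⟩, if_pos h, Int.toNat_natCast, Int.toNat_natCast,
      show ((n : ℤ) - k).toNat = n - k by omega]
    obtain ⟨l, rfl⟩ : ∃ l, n = k + l := ⟨n - k, by omega⟩
    rw [Nat.add_sub_cancel_left, ← qfac_eq, ← qfac_eq, ← qfac_eq, pow_add,
      show qfac t k * (1 - t) ^ k * (qfac t l * (1 - t) ^ l) =
        (qfac t k * qfac t l) * ((1 - t) ^ k * (1 - t) ^ l) by ring, mul_div_mul_right]
    exact mul_ne_zero (pow_ne_zero _ h1) (pow_ne_zero _ h1)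
  · rw [if_neg (by omega), if_neg h]

theorem skHL_eq {t : F} (ht : ∀ n : ℕ, t ^ (n + 1) ≠ 1) (lam mu : Partition) :
    skHL t lam mu = skc t lam.T mu.T := by
  by_cases h : ∀ i, mu.T.part i ≤ lam.T.part i
  · rw [skc_eq ht _ _ h (lam.part 0 + mu.part 0) (fun i hi => lam.T_bound (by omega))]
    rw [skHL, nskew, ← Finset.prod_pow_eq_pow_sum, ← Finset.prod_mul_distrib, prod_Icc_one]
    refine Finset.prod_congr rfl fun i _ => ?_
    rw [← lam.T_part, ← mu.T_part, ← mu.T_part, skf, ← qbinom_eq ht]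
    have h1 := h i
    have h2 := mu.T.antitone' (show i ≤ i + 1 by omega)
    rw [Nat.cast_sub h1, Nat.cast_sub (by omega)]
  · rw [skc, if_neg h]
    push Not at h
    obtain ⟨i, hi⟩ := h
    rw [skHL]
    have him : i < mu.part 0 := by
      by_contra hc
      rw [mu.T_bound (by omega)] at hi
      omega
    rw [Finset.prod_eq_zero (i := i + 1) (Finset.mem_Icc.2 ⟨by omega, by omega⟩), mul_zero]
    rw [← lam.T_part, ← mu.T_part i, qbinom, if_neg (by omega)]

/-- homogeneity -/
def Hm (n : ℕ) (f : Sym F) : Prop := ∀ d, MvPolynomial.coeff d f ≠ 0 → wt d = n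

theorem Hm_mul (m n : ℕ) (f g : Sym F) (hf : Hm m f) (hg : Hm n g) : Hm (m + n) (f * g) := by
  classical
  intro d hd
  rw [MvPolynomial.coeff_mul] at hd
  obtain ⟨x, hx, h⟩ := Finset.exists_ne_zero_of_sum_ne_zero hd
  rw [Finset.HasAntidiagonal.mem_antidiagonal] at hx
  rw [← hx, wt_add, hf _ (left_ne_zero_of_mul h), hg _ (right_ne_zero_of_mul h)]

theorem Hm_q (t : F) (r : ℕ) : Hm r (qsym t r) := by
  intro d hd
  rw [qsym, coeff_scal, coeff_hsym] at hd
  have := right_ne_zero_of_mul hd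
  by_contra h
  exact this (if_neg h)

theorem Hm_gp (t : F) (l : List ℕ) : Hm l.sum (gp (qsym t) l) := by
  classical
  induction l with
  | nil =>
    intro d hd
    rw [gp_nil, MvPolynomial.coeff_one] at hd
    have : (0 : ℕ →₀ ℕ) = d := by
      by_contra h
      exact hd (if_neg h)
    rw [← this]
    simp [wt]
  | cons b l ih =>
    rw [gp_cons, List.sum_cons]
    exact Hm_mul _ _ _ _ (Hm_q t b) ih

theorem Hm_Rc [CharZero F] (t : F) (c : Partition) : Hm c.size (Rc t c) := by
  intro d hd
  by_contra h
  apply hd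
  refine spn_zero _ _ (MvPolynomial.lcoeff F d) ?_ _ (Rc_mem t c)
  rintro l ⟨h1, -⟩
  by_contra hne
  apply h
  rw [← h1]
  exact Hm_gp t l d hne

theorem Hm_hl (t : F) (m n : ℕ) (f g : Sym F) (hf : Hm m f) (hg : Hm n g)
    (h : hl t f g ≠ 0) : m = n := by
  rw [pr_apply] at h
  unfold pr0 at h
  obtain ⟨d, -, hd⟩ := Finset.exists_ne_zero_of_sum_ne_zero h
  have := left_ne_zero_of_mul hd
  rw [← hf d (left_ne_zero_of_mul this), ← hg d (right_ne_zero_of_mul this)]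

theorem h_exp [CharZero F] {t : F} (ht : ∀ n : ℕ, t ^ (n + 1) ≠ 1) (r : ℕ) :
    hsym F r = ∑ v ∈ pf r, t ^ v.nstat • Rc t v.T := by
  let z : Partition := mkP (fun _ => 0) 0 (fun _ _ _ => le_rfl) (fun _ _ => rfl)
  have hz : ∀ i, z.part i = 0 := fun i => rfl
  have h := h_pieri ht z r
  have hsz : z.size = 0 := by rw [size_range z 0 (fun i _ => hz i)]; rfl
  rw [Rc_zero t z hz, mul_one, hsz, zero_add] at h
  rw [h]
  refine Finset.sum_bij' (fun v _ => v.T) (fun v _ => v.T) ?_ ?_ ?_ ?_ ?_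
  · intro v hv
    rw [mem_pf] at hv ⊢
    rw [v.size_T, hv]
  · intro v hv
    rw [mem_pf] at hv ⊢
    rw [v.size_T, hv]
  · intro v _
    exact v.T_T
  · intro v _
    exact v.T_T
  · intro v _
    rw [v.T_T]
    congr 1
    rw [v.T.nstat_T le_rfl, v.T_T, ← Finset.prod_pow_eq_pow_sum,
      skc_eq ht v z (fun i => by rw [hz]; omega) (v.T.part 0) (fun i hi => by
        have := v.T.T_bound hi
        rwa [v.T_T] at this)]
    refine Finset.prod_congr rfl fun i _ => ?_
    rw [hz, hz, skf, qb_self ht, mul_one, Nat.sub_zero]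

theorem lr_main [CharZero F] {t : F} (ht : ∀ n : ℕ, t ^ (n + 1) ≠ 1)
    (P : Partition → Sym F) (hP : IsMacdonald (0 : F) t P)
    (f : Partition → Partition → Partition → F)
    (hf : ∀ mu nu : Partition, P mu * P nu = ∑ᶠ lam : Partition, f mu nu lam • P lam)
    (lam mu : Partition) :
    (∑ᶠ nu : Partition, t ^ nu.nstat * f mu nu lam) = skHL t lam mu := by
  have hPR : ∀ a, P a = Rc t a.T := P_eq' ht P hP
  have hPne : ∀ a, P a ≠ 0 := fun a => by rw [hPR]; exact Rc_ne_zero ht _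
  have horth : ∀ a b, a ≠ b → hl t (P a) (P b) = 0 := fun a b h => by
    rw [← innerQT_zero]; exact hP.1 a b h
  have hnorm : ∀ a, hl t (P a) (P a) ≠ 0 := fun a => by
    rw [hPR]; exact Rc_norm ht _
  have hHm : ∀ a, Hm a.size (P a) := fun a => by
    rw [hPR, ← a.size_T]; exact Hm_Rc t _
  have hcoef : ∀ nu, hl t (P mu * P nu) (P lam) = f mu nu lam * hl t (P lam) (P lam) := by
    intro nu
    have hfin : (Function.support fun lam => f mu nu lam • P lam).Finite := by
      by_contra hinf
      have := hf mu nu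
      rw [finsum_of_infinite_support hinf] at this
      exact mul_ne_zero (hPne mu) (hPne nu) this
    rw [hf mu nu, finsum_eq_sum _ hfin, map_sum, LinearMap.sum_apply]
    rw [Finset.sum_eq_single lam]
    · rw [map_smul, LinearMap.smul_apply, smul_eq_mul]
    · intro b _ hb
      rw [map_smul, LinearMap.smul_apply, horth b lam hb, smul_zero]
    · intro h
      rw [Set.Finite.mem_toFinset, Function.mem_support, not_not] at h
      rw [h, map_zero, LinearMap.zero_apply]
  have hdeg : ∀ nu, f mu nu lam ≠ 0 → mu.size + nu.size = lam.size := by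
    intro nu h
    refine Hm_hl t _ _ _ _ (Hm_mul _ _ _ _ (hHm mu) (hHm nu)) (hHm lam) ?_
    rw [hcoef]
    exact mul_ne_zero h (hnorm lam)
  rw [skHL_eq ht]
  by_cases hsz : mu.size ≤ lam.size
  · obtain ⟨r, hr⟩ : ∃ r, lam.size = mu.size + r := ⟨lam.size - mu.size, by omega⟩
    rw [finsum_eq_sum_of_support_subset (s := pf r) _ (by
      intro nu hnu
      have := hdeg nu (right_ne_zero_of_mul hnu)
      rw [Finset.mem_coe, mem_pf]
      omega)]
    apply mul_right_cancel₀ (hnorm lam)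
    have h1 : hl t (P mu * hsym F r) (P lam) =
        (∑ nu ∈ pf r, t ^ nu.nstat * f mu nu lam) * hl t (P lam) (P lam) := by
      rw [h_exp ht, Finset.mul_sum, map_sum, LinearMap.sum_apply, Finset.sum_mul]
      refine Finset.sum_congr rfl fun nu _ => ?_
      rw [mul_smul_comm, map_smul, LinearMap.smul_apply, ← hPR, hcoef, smul_eq_mul, mul_assoc]
    rw [← h1, mul_comm, hPR mu, h_pieri ht, map_sum, LinearMap.sum_apply]
    rw [Finset.sum_eq_single lam.T]
    · rw [map_smul, LinearMap.smul_apply, ← hPR, smul_eq_mul]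
    · intro b _ hb
      have := horth b.T lam (fun h => hb (by rw [← h, b.T_T]))
      rw [hPR b.T, b.T_T] at this
      rw [map_smul, LinearMap.smul_apply, this, smul_zero]
    · intro h
      exfalso
      apply h
      rw [mem_pf, lam.size_T, mu.size_T, hr]
  · have h0 : ∀ nu, t ^ nu.nstat * f mu nu lam = 0 := by
      intro nu
      by_contra h
      have := hdeg nu (right_ne_zero_of_mul h)
      omega
    simp only [h0, finsum_zero]
    symm
    by_contra h
    apply hsz
    have hle := skc_le _ _ _ h
    have e1 := size_range lam.T (mu.T.size + lam.T.size)
      (fun i hi => lam.T.part_eq_zero (by omega))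
    have e2 := size_range mu.T (mu.T.size + lam.T.size)
      (fun i hi => mu.T.part_eq_zero (by omega))
    rw [← mu.size_T, ← lam.size_T]
    refine e2.le.trans (le_trans ?_ e1.ge)
    exact Finset.sum_le_sum fun i _ => hle i

theorem t1_pow (n : ℕ) : t1 ^ (n + 1) ≠ 1 := by
  intro h
  unfold t1 at h
  rw [← RatFunc.algebraMap_X, ← map_pow, ← map_one (algebraMap (Polynomial ℚ) (RatFunc ℚ))] at h
  have h2 := RatFunc.algebraMap_injective ℚ h
  have := congrArg Polynomial.natDegree h2
  simp at this

end PartL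

/-- Konvalinka--Lauve's Corollary 6: for all partitions
`λ, μ`, `∑_ν t^{n(ν)} f_{μν}^λ(t) = sk_{λ/μ}(t)`, the sum over all partitions
`ν`, where `f_{μν}^λ(t)` are the Hall--Littlewood Littlewood--Richardson
coefficients defined by `P_μ P_ν = ∑_λ f_{μν}^λ P_λ`. -/
theorem hall_littlewood_lr_sum
    (P : Partition → Sym F1) (hP : IsMacdonald (0 : F1) t1 P)
    (f : Partition → Partition → Partition → F1)
    (hf : ∀ mu nu : Partition, P mu * P nu = ∑ᶠ lam : Partition, f mu nu lam • P lam)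
    (lam mu : Partition) :
    (∑ᶠ nu : Partition, t1 ^ nu.nstat * f mu nu lam) = skHL t1 lam mu := by
  haveI : CharZero F1 := charZero_of_injective_algebraMap (algebraMap ℚ F1).injective
  exact lr_main t1_pow P hP f hf lam mu

end SkewPieriFormalization
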